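/- Let 0 < ε < 1/2. There is at most one fundamental discriminant D < 0 with |D| ≥ max(e^{1/ε}, e^{11.2}) such that L(1, χ_D) ≤ 0.655·ε/|D|^ε; moreover, for such an exceptional D the function L(s, χ_D) has a real zero s with 1 − ε/4 < s < 1. -/

import Mathlib

open NumberField

/-- `D` is a fundamental discriminant: either `D ≡ 1 (mod 4)` and `D` is squarefree,
or `D = 4m` for a squarefree integer `m ≡ 2` or `3 (mod 4)`. (We exclude the degenerate
case `D = 1`, so that `D` is the discriminant of a quadratic number field.) -/
def IsFundamentalDiscriminant (D : ℤ) : Prop :=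
  D ≠ 1 ∧ ((D % 4 = 1 ∧ Squarefree D) ∨
    ∃ m : ℤ, D = 4 * m ∧ Squarefree m ∧ (m % 4 = 2 ∨ m % 4 = 3))

/-- `χ` is the Kronecker character attached to the fundamental discriminant `D`: the (unique)
Dirichlet character modulo `|D|` with `χ(p) = (D/p)` (Legendre symbol) for every odd prime
`p ∤ D`. -/
def IsKroneckerChar (D : ℤ) (χ : DirichletCharacter ℂ D.natAbs) : Prop :=
  ∀ (p : ℕ) (hp : p.Prime), p ≠ 2 → ¬ ((p : ℤ) ∣ D) →
    χ (p : ZMod D.natAbs) = ((@legendreSym p ⟨hp⟩ D : ℤ) : ℂ)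

/-- The analytically continued Dirichlet L-function, extended by the junk value `0` for
modulus `0`. -/
noncomputable def LFunc {N : ℕ} (χ : DirichletCharacter ℂ N) (s : ℂ) : ℂ :=
  if h : N = 0 then 0 else
    letI : NeZero N := ⟨h⟩
    DirichletCharacter.LFunction χ s

theorem ZMod.sum_eq_sum_range {q : ℕ} [NeZero q] {M : Type*} [AddCommMonoid M] (F : ZMod q → M) :
    ∑ a, F a = ∑ i ∈ Finset.range q, F (i : ZMod q) := by
  refine Finset.sum_nbij' ZMod.val (fun i : ℕ ↦ (i : ZMod q)) ?_ ?_ ?_ ?_ ?_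
  · intro a _; simpa using ZMod.val_lt a
  · intro a _; simp
  · intro a _; simp
  · intro a ha; exact ZMod.val_cast_of_lt (by simpa using ha)
  · intro a _; simp

theorem two_mul_mul_one_sub_le_sin_pi_mul {t : ℝ} (h0 : 0 ≤ t) (h1 : t ≤ 1) :
    2 * t * (1 - t) ≤ Real.sin (Real.pi * t) := by
  have key : ∀ u : ℝ, 0 ≤ u → u ≤ 1 / 2 → 2 * u ≤ Real.sin (Real.pi * u) := by
    intro u hu0 hu
    have h := Real.mul_le_sin (x := Real.pi * u) (by positivity)
      (by nlinarith [Real.pi_pos])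
    have : 2 / Real.pi * (Real.pi * u) = 2 * u := by field_simp
    linarith
  rcases le_total t (1 / 2) with h | h
  · nlinarith [key t h0 h]
  · have h2 := key (1 - t) (by linarith) (by linarith)
    rw [show Real.pi * (1 - t) = Real.pi - Real.pi * t by ring, Real.sin_pi_sub] at h2
    nlinarith

theorem norm_sum_stdAddChar_pow_le {q : ℕ} [NeZero q] {a : ℕ} (ha : 0 < a) (haq : a < q) (x : ℕ) :
    ‖∑ n ∈ Finset.range x, (ZMod.stdAddChar ((n : ZMod q) * (a : ZMod q)) : ℂ)‖
      ≤ q / 2 * (1 / a + 1 / ((q : ℝ) - a)) := by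
  have hq : (0 : ℝ) < q := by exact_mod_cast (ha.trans haq)
  have ha' : (0 : ℝ) < a := by exact_mod_cast ha
  have haq' : (a : ℝ) < q := by exact_mod_cast haq
  set t : ℝ := a / q with ht
  have ht0 : 0 < t := by positivity
  have ht1 : t < 1 := by rw [ht, div_lt_one hq]; exact haq'
  set w : ℂ := ZMod.stdAddChar (a : ZMod q) with hw
  have hwexp : w = Complex.exp (Complex.I * ((2 * Real.pi * t : ℝ) : ℂ)) := by
    have := ZMod.stdAddChar_coe (N := q) (a : ℤ)
    rw [hw]
    push_cast at this
    rw [this]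
    congr 1
    simp only [ht]
    push_cast
    ring
  have hnorm : ‖w - 1‖ = 2 * Real.sin (Real.pi * t) := by
    rw [hwexp, Complex.norm_exp_I_mul_ofReal_sub_one]
    rw [show 2 * Real.pi * t / 2 = Real.pi * t by ring, Real.norm_of_nonneg]
    have := Real.sin_nonneg_of_nonneg_of_le_pi (x := Real.pi * t) (by positivity)
      (by nlinarith [Real.pi_pos])
    positivity
  have hsin := two_mul_mul_one_sub_le_sin_pi_mul ht0.le ht1.le
  have hpos : 0 < t * (1 - t) := mul_pos ht0 (by linarith)
  have hw1 : w ≠ 1 := by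
    intro h
    rw [h, sub_self, norm_zero] at hnorm
    nlinarith
  have hnw : ‖w‖ = 1 := by rw [hwexp, mul_comm]; exact Complex.norm_exp_ofReal_mul_I _
  have hsum : ∑ n ∈ Finset.range x, (ZMod.stdAddChar ((n : ZMod q) * (a : ZMod q)) : ℂ)
      = (w ^ x - 1) / (w - 1) := by
    rw [← geom_sum_eq hw1]
    refine Finset.sum_congr rfl fun n _ ↦ ?_
    rw [hw, ← AddChar.map_nsmul_eq_pow, nsmul_eq_mul]
  rw [hsum, norm_div, hnorm]
  have h2 : ‖w ^ x - 1‖ ≤ 2 := by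
    refine (norm_sub_le _ _).trans ?_
    rw [norm_pow, hnw]; norm_num
  have hqa : (0 : ℝ) < q - a := by linarith
  have e : q / 2 * (1 / a + 1 / ((q : ℝ) - a)) = 2 / (2 * (2 * t * (1 - t))) := by
    rw [ht]; field_simp; ring
  rw [e]
  gcongr

theorem norm_gaussSum_sq {q : ℕ} [NeZero q] {χ : DirichletCharacter ℂ q} (hχ : χ.IsPrimitive) :
    ‖gaussSum χ (ZMod.stdAddChar (N := q))‖ ^ 2 = q := by
  classical
  set e := (ZMod.stdAddChar (N := q)) with he
  have hinv : (χ⁻¹).IsPrimitive := by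
    rw [DirichletCharacter.isPrimitive_def, DirichletCharacter.conductor_inv]; exact hχ
  have hep : e.IsPrimitive := ZMod.isPrimitive_stdAddChar q
  have h1 : gaussSum χ e * star (gaussSum χ e) = q := by
    rw [star_gaussSum_eq, gaussSum, Finset.sum_mul]
    calc ∑ a, χ a * e a * gaussSum χ⁻¹ e⁻¹
        = ∑ a, e a * gaussSum χ⁻¹ (e⁻¹.mulShift a) := by
          refine Finset.sum_congr rfl fun a _ ↦ ?_
          rw [gaussSum_mulShift_of_isPrimitive _ hinv, inv_inv]; ring
      _ = ∑ b, χ⁻¹ b * ∑ a, e (a * (1 - b)) := by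
          simp_rw [gaussSum, Finset.mul_sum]
          rw [Finset.sum_comm]
          refine Finset.sum_congr rfl fun b _ ↦ Finset.sum_congr rfl fun a _ ↦ ?_
          rw [AddChar.mulShift_apply, AddChar.inv_apply, mul_sub, mul_one, sub_eq_add_neg,
            AddChar.map_add_eq_mul]
          ring
      _ = q := by
          simp_rw [AddChar.sum_mulShift _ hep, sub_eq_zero]
          simp
  have h2 : ((‖gaussSum χ e‖ ^ 2 : ℝ) : ℂ) = q := by
    rw [← h1, Complex.star_def, Complex.mul_conj, Complex.normSq_eq_norm_sq]
  exact_mod_cast h2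

theorem DirichletCharacter.norm_sum_range_le_of_isPrimitive {q : ℕ} [NeZero q] (hq : 1 < q)
    {χ : DirichletCharacter ℂ q} (hχ : χ.IsPrimitive) (x : ℕ) :
    ‖∑ n ∈ Finset.range x, χ n‖ ≤ √q * (1 + Real.log q) := by
  set e := (ZMod.stdAddChar (N := q)) with he
  have hinv : (χ⁻¹).IsPrimitive := by
    rw [DirichletCharacter.isPrimitive_def, DirichletCharacter.conductor_inv]; exact hχ
  have hq0 : (0 : ℝ) < q := by exact_mod_cast (by omega : 0 < q)
  have hτ : ‖gaussSum χ⁻¹ e‖ = √q := by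
    rw [← norm_gaussSum_sq hinv, Real.sqrt_sq (norm_nonneg _)]
  have h1 : (∑ n ∈ Finset.range x, χ n) * gaussSum χ⁻¹ e
      = ∑ a ∈ Finset.range q, χ⁻¹ (a : ZMod q) *
        ∑ n ∈ Finset.range x, e ((n : ZMod q) * (a : ZMod q)) := by
    rw [← ZMod.sum_eq_sum_range (F := fun a ↦ χ⁻¹ a * ∑ n ∈ Finset.range x, e ((n : ZMod q) * a)),
      Finset.sum_mul]
    simp_rw [Finset.mul_sum]
    rw [Finset.sum_comm]
    refine Finset.sum_congr rfl fun n _ ↦ ?_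
    have := gaussSum_mulShift_of_isPrimitive e hinv (n : ZMod q)
    rw [inv_inv] at this
    rw [← this, gaussSum]
    rfl
  have h2 : ‖∑ n ∈ Finset.range x, χ n‖ * √q ≤ q * (1 + Real.log q) := by
    rw [← hτ, ← norm_mul, h1]
    obtain ⟨r, rfl⟩ : ∃ r, q = r + 1 := ⟨q - 1, by omega⟩
    rw [Finset.sum_range_succ']
    have hz : χ⁻¹ ((0 : ℕ) : ZMod (r + 1)) = 0 := by
      rw [Nat.cast_zero]
      exact DirichletCharacter.map_zero' _ (by omega)
    rw [hz, zero_mul, add_zero]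
    calc _ ≤ ∑ a ∈ Finset.range r, ((r + 1 : ℕ) : ℝ) / 2 *
          (1 / ((a + 1 : ℕ) : ℝ) + 1 / (((r + 1 : ℕ) : ℝ) - ((a + 1 : ℕ) : ℝ))) := by
          refine norm_sum_le_of_le _ fun a ha ↦ ?_
          rw [Finset.mem_range] at ha
          rw [norm_mul]
          have h3 := norm_sum_stdAddChar_pow_le (q := r + 1) (a := a + 1) (by omega) (by omega) x
          have h4 := DirichletCharacter.norm_le_one χ⁻¹ ((a + 1 : ℕ) : ZMod (r + 1))
          calc _ ≤ 1 * ‖∑ n ∈ Finset.range x,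
                e ((n : ZMod (r + 1)) * ((a + 1 : ℕ) : ZMod (r + 1)))‖ := by gcongr
            _ ≤ _ := by rw [one_mul]; exact h3
      _ = ((r + 1 : ℕ) : ℝ) * ∑ a ∈ Finset.range r, 1 / ((a + 1 : ℕ) : ℝ) := by
          rw [← Finset.mul_sum, Finset.sum_add_distrib]
          have : ∑ a ∈ Finset.range r, 1 / (((r + 1 : ℕ) : ℝ) - ((a + 1 : ℕ) : ℝ))
              = ∑ a ∈ Finset.range r, 1 / ((a + 1 : ℕ) : ℝ) := by
            rw [← Finset.sum_range_reflect]
            refine Finset.sum_congr rfl fun a ha ↦ ?_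
            rw [Finset.mem_range] at ha
            congr 1
            rw [← Nat.cast_sub (by omega)]
            congr 1
            omega
          rw [this]; ring
      _ ≤ _ := by
          gcongr
          have h5 := harmonic_le_one_add_log r
          have h6 : ((harmonic r : ℚ) : ℝ) = ∑ a ∈ Finset.range r, 1 / ((a + 1 : ℕ) : ℝ) := by
            simp [harmonic]
          rw [← h6]
          refine h5.trans ?_
          rcases Nat.eq_zero_or_pos r with rfl | hr
          · simp
          · gcongr
            omega
  have hs : √(q : ℝ) * √q = q := Real.mul_self_sqrt hq0.le
  have hs0 : 0 < √(q : ℝ) := Real.sqrt_pos.mpr hq0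
  nth_rewrite 2 [← hs] at h2
  refine le_of_mul_le_mul_right ?_ hs0
  linarith

theorem Nat.card_divisors_le_two_mul_sqrt (n : ℕ) : (n.divisors.card : ℝ) ≤ 2 * √n := by
  rcases Nat.eq_zero_or_pos n with rfl | hn
  · simp
  have h1 : n.divisors ⊆ Finset.Icc 1 n.sqrt ∪ (Finset.Icc 1 n.sqrt).image (fun d ↦ n / d) := by
    intro d hd
    have hdn := Nat.dvd_of_mem_divisors hd
    have hd0 := Nat.pos_of_mem_divisors hd
    rw [Finset.mem_union, Finset.mem_image]
    by_cases h : d ≤ n.sqrt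
    · left; simp; omega
    · right
      refine ⟨n / d, ?_, Nat.div_div_self hdn hn.ne'⟩
      rw [Finset.mem_Icc]
      refine ⟨Nat.div_pos (Nat.le_of_dvd hn hdn) hd0, ?_⟩
      by_contra h'
      push Not at h h'
      have h3 : n / d * d = n := Nat.div_mul_cancel hdn
      have h4 := Nat.sqrt_lt.mp (lt_of_lt_of_le (Nat.lt_succ_self n.sqrt) (Nat.succ_le_of_lt h))
      have h5 := Nat.lt_succ_sqrt n
      nlinarith [Nat.mul_le_mul (Nat.succ_le_of_lt h') (Nat.succ_le_of_lt h)]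
  have h2 : n.divisors.card ≤ 2 * n.sqrt := by
    refine (Finset.card_le_card h1).trans ((Finset.card_union_le _ _).trans ?_)
    have := Finset.card_image_le (s := Finset.Icc 1 n.sqrt) (f := fun d ↦ n / d)
    simp only [Nat.card_Icc] at this ⊢
    omega
  have h3 : (n.sqrt : ℝ) ≤ √n := Real.nat_sqrt_le_real_sqrt
  calc (n.divisors.card : ℝ) ≤ ((2 * n.sqrt : ℕ) : ℝ) := by exact_mod_cast h2
    _ ≤ _ := by push_cast; linarith

theorem DirichletCharacter.norm_sum_range_le {N : ℕ} [NeZero N] {χ : DirichletCharacter ℂ N}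
    (hχ : χ ≠ 1) (x : ℕ) :
    ‖∑ n ∈ Finset.range x, χ n‖ ≤ 2 * √N * (1 + Real.log N) := by
  set q := χ.conductor with hq
  set ψ := χ.primitiveCharacter with hψ
  have hqN : q ∣ N := χ.conductor_dvd_level
  have : NeZero q := ⟨χ.conductor_ne_zero⟩
  have hN0 : N ≠ 0 := NeZero.ne N
  have hq1 : 1 < q := by
    have h1 : q ≠ 1 := fun h ↦ hχ (DirichletCharacter.eq_one_iff_conductor_eq_one.mpr h)
    have h0 : q ≠ 0 := NeZero.ne q
    omega
  obtain ⟨m, hm⟩ := hqN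
  have hm0 : m ≠ 0 := by rintro rfl; simp at hm; exact hN0 hm
  have hval : ∀ n : ℕ, χ n =
        ∑ d ∈ m.divisors with d ∣ n, (ArithmeticFunction.moebius d : ℂ) * ψ n := by
    intro n
    rw [← Finset.sum_mul]
    have hfil : (m.divisors.filter (· ∣ n)) = (n.gcd m).divisors := by
      ext d
      simp [Nat.dvd_gcd_iff, hm0, Nat.gcd_eq_zero_iff]
      tauto
    have hmob : ∑ d ∈ (n.gcd m).divisors, (ArithmeticFunction.moebius d : ℂ)
        = if n.gcd m = 1 then 1 else 0 := by
      have := congrArg (fun f : ArithmeticFunction ℤ ↦ f (n.gcd m))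
        ArithmeticFunction.coe_zeta_mul_moebius
      simp only [ArithmeticFunction.coe_zeta_mul_apply, ArithmeticFunction.one_apply] at this
      exact_mod_cast this
    rw [hfil, hmob]
    by_cases hc : IsCoprime (n : ℤ) N
    · have h2 := χ.primitiveCharacter_apply_of_isCoprime hc
      have h3 : n.gcd m = 1 := by
        have := Nat.isCoprime_iff_coprime.mp hc
        rw [hm] at this
        exact Nat.Coprime.coprime_mul_left_right this
      rw [if_pos h3, one_mul]
      exact_mod_cast h2.symm
    · have h2 : χ n = 0 := by
        have := (χ.apply_eq_zero_iff n).mpr hc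
        exact_mod_cast this
      rw [h2]
      by_cases h3 : n.gcd m = 1
      · have h4 : ¬ IsCoprime (n : ℤ) q := by
          intro h4
          apply hc
          rw [Nat.isCoprime_iff_coprime] at h4 ⊢
          rw [hm]
          exact Nat.Coprime.mul_right h4 h3
        have h5 : ψ n = 0 := by
          have := (ψ.apply_eq_zero_iff n).mpr h4
          exact_mod_cast this
        rw [h5, mul_zero]
      · rw [if_neg h3, zero_mul]
  have hsum : ∑ n ∈ Finset.range x, χ n = ∑ d ∈ m.divisors, (ArithmeticFunction.moebius d : ℂ) *
      (ψ d * ∑ j ∈ Finset.range ((x + d - 1) / d), ψ j) := by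
    simp_rw [hval, Finset.sum_filter]
    rw [Finset.sum_comm]
    refine Finset.sum_congr rfl fun d hd ↦ ?_
    have hd0 : 0 < d := Nat.pos_of_mem_divisors hd
    rw [← Finset.sum_filter, ← Finset.mul_sum]
    congr 1
    rw [Finset.mul_sum]
    symm
    refine Finset.sum_nbij (fun j ↦ d * j) ?_ ?_ ?_ ?_
    · intro j hj
      simp only [Finset.mem_filter, Finset.mem_range] at hj ⊢
      refine ⟨?_, Dvd.intro _ rfl⟩
      have := (Nat.lt_div_iff_mul_lt hd0).mp hj
      rw [mul_comm]; omega
    · intro a _ b _ h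
      exact Nat.eq_of_mul_eq_mul_left hd0 h
    · intro n hn
      simp only [Finset.coe_filter, Finset.mem_range, Set.mem_ofPred_eq] at hn
      obtain ⟨hn, j, rfl⟩ := hn
      refine ⟨j, ?_, rfl⟩
      simp only [Finset.coe_range, Set.mem_Iio]
      rw [Nat.lt_div_iff_mul_lt hd0, mul_comm]
      omega
    · intro j _
      push_cast
      rw [map_mul]
  rw [hsum]
  have hNr : (N : ℝ) = q * m := by rw [hm]; push_cast; rfl
  have hq1' : (1 : ℝ) < q := by exact_mod_cast hq1
  have hm1' : (1 : ℝ) ≤ m := by exact_mod_cast Nat.pos_of_ne_zero hm0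
  calc _ ≤ ∑ d ∈ m.divisors, √q * (1 + Real.log q) := by
        refine norm_sum_le_of_le _ fun d _ ↦ ?_
        rw [norm_mul, norm_mul]
        have h1 : ‖(ArithmeticFunction.moebius d : ℂ)‖ ≤ 1 := by
          rw [Complex.norm_intCast]
          exact_mod_cast ArithmeticFunction.abs_moebius_le_one
        have h2 := DirichletCharacter.norm_le_one ψ d
        have h3 := DirichletCharacter.norm_sum_range_le_of_isPrimitive hq1
          χ.primitiveCharacter_isPrimitive ((x + d - 1) / d)
        calc _ ≤ 1 * (1 * (√q * (1 + Real.log q))) := by gcongr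
          _ = _ := by ring
    _ = (m.divisors.card : ℝ) * (√q * (1 + Real.log q)) := by
        rw [Finset.sum_const, nsmul_eq_mul]
    _ ≤ (2 * √m) * (√q * (1 + Real.log N)) := by
        have hlq : 0 ≤ Real.log q := Real.log_nonneg hq1'.le
        have hqN : (q : ℝ) ≤ N := by rw [hNr]; nlinarith
        gcongr
        exact Nat.card_divisors_le_two_mul_sqrt m
    _ = _ := by
        rw [hNr, Real.sqrt_mul (by positivity)]; ring

theorem jacobiSym_eq_one_of_modEq_one {w : ℤ} {n : ℕ} (hn : n ≡ 1 [MOD 4 * w.natAbs]) :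
    jacobiSym w n = 1 := by
  have h4 : n ≡ 1 [MOD 4] := hn.of_mul_right _
  have hodd : Odd n := by rw [Nat.odd_iff]; unfold Nat.ModEq at h4; omega
  rw [jacobiSym.mod_right w hodd, hn, ← jacobiSym.mod_right w odd_one, jacobiSym.one_right]

theorem jacobiSym_sq_mul_of_modEq_one {g n : ℕ} (hn : n ≡ 1 [MOD g]) (w : ℤ) :
    jacobiSym (w * (g : ℤ) ^ 2) n = jacobiSym w n := by
  rw [jacobiSym.mul_left, jacobiSym.sq_one', mul_one]
  rw [Int.gcd_natCast_natCast, Nat.gcd_comm, hn.gcd_eq, Nat.gcd_one_left]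

theorem exists_jacobiSym_eq_neg_one_of_odd_prime {r : ℕ} (hr : r.Prime) (hr2 : r ≠ 2) {w : ℤ}
    (hw : ¬ (r : ℤ) ∣ w) (i : ℕ) : ∃ n : ℕ, Odd n ∧
      jacobiSym ((r : ℤ) ^ (2 * i + 1) * w) n = -1 := by
  have : Fact r.Prime := ⟨hr⟩
  obtain ⟨a, ha⟩ := FiniteField.exists_nonsquare (F := ZMod r) (by rwa [ZMod.ringChar_zmod_n])
  have hcop : Nat.Coprime (4 * w.natAbs) r := by
    rw [Nat.coprime_comm, Nat.Prime.coprime_iff_not_dvd hr, Nat.Prime.dvd_mul hr]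
    rintro (h | h)
    · have : r ∣ 2 ^ 2 := by simpa using h
      exact hr2 ((Nat.prime_dvd_prime_iff_eq hr Nat.prime_two).mp (hr.dvd_of_dvd_pow this))
    · exact hw (Int.natCast_dvd.mpr h)
  obtain ⟨n, hn1, hn2⟩ := Nat.chineseRemainder hcop 1 a.val
  have h4 : n % 4 = 1 := by
    have : n ≡ 1 [MOD 4] := hn1.of_mul_right _
    exact this
  have hodd : Odd n := by rw [Nat.odd_iff]; omega
  have hrodd : Odd r := hr.odd_of_ne_two hr2
  have hrn : jacobiSym r n = -1 := by
    rw [jacobiSym.quadratic_reciprocity_one_mod_four' hrodd h4]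
    refine (ZMod.nonsquare_iff_jacobiSym_eq_neg_one (p := r)).mpr ?_
    have : (((n : ℕ) : ℤ) : ZMod r) = a := by
      have := (ZMod.natCast_eq_natCast_iff _ _ _).mpr hn2
      rw [ZMod.natCast_zmod_val] at this
      exact_mod_cast this
    rwa [this]
  refine ⟨n, hodd, ?_⟩
  rw [jacobiSym.mul_left, jacobiSym.pow_left, hrn, jacobiSym_eq_one_of_modEq_one hn1, mul_one]
  exact Odd.neg_one_pow ⟨i, rfl⟩

theorem exists_jacobiSym_eq_neg_one {a : ℤ} (ha : ¬ IsSquare a) :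
    ∃ n : ℕ, Odd n ∧ jacobiSym a n = -1 := by
  have ha0 : a ≠ 0 := by rintro rfl; simp at ha
  obtain ⟨s, b, hsb, hs⟩ := Nat.sq_mul_squarefree a.natAbs
  have hb0 : b ≠ 0 := by rintro rfl; simp at hsb; exact ha0 (Int.natAbs_eq_zero.mp hsb.symm)
  have hs0 : s ≠ 0 := hs.ne_zero
  obtain ⟨ε, hε, haε⟩ : ∃ ε : ℤ, (ε = 1 ∨ ε = -1) ∧ a = ε * ((b : ℤ) ^ 2 * s) := by
    rcases Int.natAbs_eq a with h | h
    · exact ⟨1, Or.inl rfl, by rw [one_mul, h, ← hsb]; push_cast; ring⟩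
    · exact ⟨-1, Or.inr rfl, by rw [h, ← hsb]; push_cast; ring⟩
  by_cases hodd : ∃ r : ℕ, r.Prime ∧ r ≠ 2 ∧ r ∣ s
  · obtain ⟨r, hr, hr2, t, rfl⟩ := hodd
    have hrt : ¬ r ∣ t := by
      rintro ⟨t', rfl⟩
      exact hr.not_isUnit (hs r ⟨t', by ring⟩)
    obtain ⟨i, b', hb', rfl⟩ := Nat.exists_eq_pow_mul_and_not_dvd hb0 r hr.ne_one
    have hpr : Prime (r : ℤ) := Nat.prime_iff_prime_int.mp hr
    have hw : ¬ (r : ℤ) ∣ ε * ((b' : ℤ) ^ 2 * t) := by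
      intro h
      rcases hpr.dvd_or_dvd h with h | h
      · have : (r : ℤ) ∣ 1 := by rcases hε with rfl | rfl <;> simpa using h
        exact hpr.not_dvd_one this
      · rcases hpr.dvd_or_dvd h with h | h
        · exact hb' (by exact_mod_cast hpr.dvd_of_dvd_pow h)
        · exact hrt (by exact_mod_cast h)
    obtain ⟨n, hn, h⟩ := exists_jacobiSym_eq_neg_one_of_odd_prime hr hr2 hw i
    refine ⟨n, hn, ?_⟩
    rw [← h, haε]
    congr 1
    push_cast
    ring
  · push Not at hodd
    obtain ⟨i, g, hg, rfl⟩ := Nat.exists_eq_pow_mul_and_not_dvd hb0 2 (by norm_num)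
    have hg2 : g % 2 = 1 := by omega
    have hs2 : s = 1 ∨ s = 2 := by
      have h : ∀ {p : ℕ}, p.Prime → p ∣ s → p = 2 := fun hp hps ↦ by
        by_contra h; exact hodd _ hp h hps
      obtain ⟨k, hk⟩ := Nat.dvd_prime_pow Nat.prime_two |>.mp
        (dvd_of_eq (Nat.eq_prime_pow_of_unique_prime_dvd hs0 h))
      rcases hk with ⟨_, rfl⟩
      have : k ≤ 1 := by
        by_contra hk
        have h4 : 2 * 2 ∣ 2 ^ k := by
          rw [show 2 * 2 = 2 ^ 2 by norm_num]; exact pow_dvd_pow 2 (by omega)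
        exact Nat.prime_two.not_isUnit (hs 2 h4)
      interval_cases k
      · left; rfl
      · right; rfl
    have hcop : Nat.Coprime g 8 := by
      rw [show 8 = 2 ^ 3 by norm_num]
      exact Nat.Coprime.pow_right _ (Nat.coprime_two_right.mpr (Nat.odd_iff.mpr hg2))
    have key : ∀ c, c % 2 = 1 → ∃ n : ℕ, Odd n ∧ n % 8 = c % 8 ∧
        jacobiSym a n = jacobiSym (ε * s) n := by
      intro c hc
      obtain ⟨n, hn1, hn2⟩ := Nat.chineseRemainder hcop 1 c
      have hn8 : n % 8 = c % 8 := hn2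
      have hn : Odd n := by rw [Nat.odd_iff]; omega
      refine ⟨n, hn, hn8, ?_⟩
      have h1 : a = ε * s * ((2 ^ i : ℕ) : ℤ) ^ 2 * (g : ℤ) ^ 2 := by
        rw [haε]; push_cast; ring
      rw [h1, jacobiSym_sq_mul_of_modEq_one hn1, jacobiSym.mul_left (ε * s), jacobiSym.sq_one',
        mul_one]
      rw [Int.gcd_natCast_natCast]
      exact Nat.Coprime.pow_left _ (Nat.coprime_two_left.mpr hn)
    rcases hs2 with rfl | rfl
    · rcases hε with rfl | rfl
      · exact absurd ⟨((2 ^ i * g : ℕ) : ℤ), by rw [haε]; push_cast; ring⟩ ha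
      · obtain ⟨n, hn, hn8, h⟩ := key 3 rfl
        refine ⟨n, hn, ?_⟩
        rw [h, Nat.cast_one, mul_one, jacobiSym.at_neg_one hn]
        exact ZMod.χ₄_nat_three_mod_four (by omega)
    · obtain ⟨n, hn, hn8, h⟩ := key 5 rfl
      refine ⟨n, hn, ?_⟩
      have hc : ((n : ℕ) : ZMod 8) = 5 := by
        have := (ZMod.natCast_eq_natCast_iff n 5 8).mpr hn8
        exact_mod_cast this
      rcases hε with rfl | rfl
      · rw [h, one_mul, Nat.cast_ofNat, jacobiSym.at_two hn, hc]; rfl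
      · rw [h, Nat.cast_ofNat, show (-1 * 2 : ℤ) = -2 by norm_num, jacobiSym.at_neg_two hn, hc]; rfl

theorem exists_prime_legendreSym_eq_neg_one {a : ℤ} (ha : ¬ IsSquare a) :
    ∃ (p : ℕ) (hp : p.Prime), p ≠ 2 ∧ ¬ ((p : ℤ) ∣ a) ∧ @legendreSym p ⟨hp⟩ a = -1 := by
  obtain ⟨n, hn, h⟩ := exists_jacobiSym_eq_neg_one ha
  obtain ⟨p, hp, hpn, h'⟩ := jacobiSym.eq_neg_one_at_prime_divisor_of_eq_neg_one h
  have : Fact p.Prime := ⟨hp⟩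
  rw [← jacobiSym.legendreSym.to_jacobiSym] at h'
  refine ⟨p, hp, ?_, ?_, h'⟩
  · rintro rfl
    exact (Nat.not_even_iff_odd.mpr hn) (even_iff_two_dvd.mpr hpn)
  · intro hd
    have := (legendreSym.eq_zero_iff p a).mpr ((ZMod.intCast_zmod_eq_zero_iff_dvd a p).mpr hd)
    omega

theorem IsFundamentalDiscriminant.ne_zero {D : ℤ} (h : IsFundamentalDiscriminant D) : D ≠ 0 := by
  rcases h with ⟨_, ⟨_, h⟩ | ⟨m, rfl, hm, _⟩⟩
  · exact h.ne_zero
  · simpa using hm.ne_zero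

theorem Int.eq_of_squarefree_of_isSquare_mul {a b : ℤ} (ha : Squarefree a) (hb : Squarefree b)
    (h : IsSquare (a * b)) : a = b := by
  obtain ⟨z, hz⟩ := h
  have h1 : a ∣ z := (ha.dvd_pow_iff_dvd two_ne_zero).mp ⟨b, by rw [sq, hz]⟩
  obtain ⟨c, rfl⟩ := h1
  have h2 : b = a * (c * c) := by
    apply mul_left_cancel₀ ha.ne_zero
    rw [hz]; ring
  have h3 : IsUnit c := hb c ⟨a, by rw [h2]; ring⟩
  rcases Int.isUnit_iff.mp h3 with rfl | rfl <;> simp [h2]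

theorem IsFundamentalDiscriminant.eq_of_isSquare_mul {D₁ D₂ : ℤ} (h₁ : IsFundamentalDiscriminant D₁)
    (h₂ : IsFundamentalDiscriminant D₂) (h : IsSquare (D₁ * D₂)) : D₁ = D₂ := by
  have aux : ∀ x : ℤ, IsSquare (4 * x) → IsSquare x := by
    rintro x ⟨z, hz⟩
    have h2 : (2 : ℤ) ∣ z := by
      have : (2 : ℤ) ∣ z * z := ⟨2 * x, by rw [← hz]; ring⟩
      rcases Int.prime_two.dvd_or_dvd this with h | h <;> exact h
    obtain ⟨y, rfl⟩ := h2
    exact ⟨y, by linarith⟩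
  rcases h₁ with ⟨_, ⟨h1, hs1⟩ | ⟨m₁, rfl, hs1, h1⟩⟩ <;>
    rcases h₂ with ⟨_, ⟨h2, hs2⟩ | ⟨m₂, rfl, hs2, h2⟩⟩
  · exact Int.eq_of_squarefree_of_isSquare_mul hs1 hs2 h
  · have := Int.eq_of_squarefree_of_isSquare_mul hs1 hs2 (aux _ (by convert h using 1; ring))
    omega
  · have := Int.eq_of_squarefree_of_isSquare_mul hs1 hs2 (aux _ (by convert h using 1; ring))
    omega
  · rw [Int.eq_of_squarefree_of_isSquare_mul hs1 hs2
      (aux _ (aux _ (by convert h using 1; ring)))]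

theorem IsKroneckerChar.sq_eq_one {D : ℤ} (hD : D ≠ 0) {χ : DirichletCharacter ℂ D.natAbs}
    (hχ : IsKroneckerChar D χ) : χ ^ 2 = 1 := by
  have : NeZero D.natAbs := ⟨Int.natAbs_ne_zero.mpr hD⟩
  ext a
  obtain ⟨p, hpD, hp, hpa⟩ := Nat.forall_exists_prime_gt_and_eq_mod a.isUnit (max 2 D.natAbs)
  have h2 : p ≠ 2 := by have := le_max_left 2 D.natAbs; omega
  have hd : ¬ (p : ℤ) ∣ D := by
    intro h
    have := Nat.le_of_dvd (Int.natAbs_pos.mpr hD) (Int.natCast_dvd.mp h)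
    have := le_max_right 2 D.natAbs
    omega
  have h := hχ p hp h2 hd
  have : Fact p.Prime := ⟨hp⟩
  rw [hpa] at h
  rw [MulChar.pow_apply_coe, h, MulChar.one_apply_coe]
  have h3 : legendreSym p D ^ 2 = 1 := legendreSym.sq_one p (by
    rwa [Ne, ZMod.intCast_zmod_eq_zero_iff_dvd])
  exact_mod_cast h3

theorem IsKroneckerChar.ne_one {D : ℤ} (hD : D < 0) {χ : DirichletCharacter ℂ D.natAbs}
    (hχ : IsKroneckerChar D χ) : χ ≠ 1 := by
  have hsq : ¬ IsSquare D := fun ⟨z, hz⟩ ↦ by nlinarith [mul_self_nonneg z]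
  obtain ⟨p, hp, h2, hd, h⟩ := exists_prime_legendreSym_eq_neg_one hsq
  rintro rfl
  have h3 := hχ p hp h2 hd
  rw [h] at h3
  by_cases hu : IsUnit (p : ZMod D.natAbs)
  · rw [MulChar.one_apply hu] at h3
    norm_num at h3
  · rw [MulChar.map_nonunit _ hu] at h3
    norm_num at h3

theorem IsKroneckerChar.changeLevel_mul_ne_one {D₁ D₂ : ℤ}
    (h : ¬ IsSquare (D₁ * D₂))
    {χ₁ : DirichletCharacter ℂ D₁.natAbs} {χ₂ : DirichletCharacter ℂ D₂.natAbs}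
    (hχ₁ : IsKroneckerChar D₁ χ₁) (hχ₂ : IsKroneckerChar D₂ χ₂) :
    DirichletCharacter.changeLevel (dvd_mul_right D₁.natAbs D₂.natAbs) χ₁ *
      DirichletCharacter.changeLevel (dvd_mul_left D₂.natAbs D₁.natAbs) χ₂ ≠ 1 := by
  obtain ⟨p, hp, h2, hd, h⟩ := exists_prime_legendreSym_eq_neg_one h
  have hd1 : ¬ (p : ℤ) ∣ D₁ := fun h ↦ hd (h.mul_right _)
  have hd2 : ¬ (p : ℤ) ∣ D₂ := fun h ↦ hd (h.mul_left _)
  have e1 := hχ₁ p hp h2 hd1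
  have e2 := hχ₂ p hp h2 hd2
  have hu : IsUnit (p : ZMod (D₁.natAbs * D₂.natAbs)) := by
    rw [ZMod.isUnit_iff_coprime, hp.coprime_iff_not_dvd, hp.dvd_mul]
    rintro (h | h)
    · exact hd1 (Int.natCast_dvd.mpr h)
    · exact hd2 (Int.natCast_dvd.mpr h)
  intro hone
  have h3 := congrArg (fun χ : DirichletCharacter ℂ _ ↦ χ (p : ZMod (D₁.natAbs * D₂.natAbs))) hone
  have : Fact p.Prime := ⟨hp⟩
  have hcop : IsCoprime (p : ℤ) ((D₁.natAbs * D₂.natAbs : ℕ) : ℤ) :=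
    Nat.isCoprime_iff_coprime.mpr ((ZMod.isUnit_iff_coprime _ _).mp hu)
  have c1 := DirichletCharacter.changeLevel_eq_cast_of_dvd' χ₁
    (dvd_mul_right D₁.natAbs D₂.natAbs) hcop
  have c2 := DirichletCharacter.changeLevel_eq_cast_of_dvd' χ₂
    (dvd_mul_left D₂.natAbs D₁.natAbs) hcop
  simp only [Int.cast_natCast] at c1 c2
  simp only [MulChar.mul_apply, c1, c2, e1, e2, MulChar.one_apply hu] at h3
  have h4 : legendreSym p (D₁ * D₂) = 1 := by
    rw [legendreSym.mul]
    exact_mod_cast h3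
  rw [h] at h4
  norm_num at h4

theorem exists_isKroneckerChar_of_mod_four_eq_one {D : ℤ} (hD : D < 0) (h4 : D % 4 = 1) :
    ∃ χ : DirichletCharacter ℂ D.natAbs, IsKroneckerChar D χ := by
  have : NeZero D.natAbs := ⟨Int.natAbs_ne_zero.mpr hD.ne⟩
  set k := D.natAbs with hk
  have hDk : D = -(k : ℤ) := by omega
  have hk3 : k % 4 = 3 := by omega
  have hmul : ∀ a b : ZMod k, jacobiSym ((a * b).val : ℤ) k =
      jacobiSym (a.val : ℤ) k * jacobiSym (b.val : ℤ) k := by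
    intro a b
    rw [ZMod.val_mul, ← jacobiSym.mul_left, jacobiSym.mod_left (_ * _)]
    push_cast
    rfl
  refine ⟨⟨⟨⟨fun a ↦ ((jacobiSym (a.val : ℤ) k : ℤ) : ℂ), ?_⟩, ?_⟩, ?_⟩, ?_⟩
  · rw [ZMod.val_one_eq_one_mod, Int.natCast_mod, ← jacobiSym.mod_left]
    simp
  · intro a b
    simp only [hmul]
    push_cast; rfl
  · intro a ha
    have : jacobiSym (a.val : ℤ) k = 0 := by
      rw [jacobiSym.eq_zero_iff_not_coprime, Int.gcd_natCast_natCast]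
      intro h
      apply ha
      have := (ZMod.isUnit_iff_coprime a.val k).mpr h
      rwa [ZMod.natCast_zmod_val] at this
    simp only [this, Int.cast_zero]
  · intro p hp hp2 hd
    have : Fact p.Prime := ⟨hp⟩
    have hpo := hp.odd_of_ne_two hp2
    have hko : Odd k := Nat.odd_iff.mpr (by omega)
    change ((jacobiSym (((p : ZMod k)).val : ℤ) k : ℤ) : ℂ) = _
    rw [ZMod.val_natCast, Int.natCast_mod, ← jacobiSym.mod_left, jacobiSym.legendreSym.to_jacobiSym,
      hDk,
      jacobiSym.neg _ hpo]
    congr 1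
    rcases Nat.odd_mod_four_iff.mp (Nat.odd_iff.mp hpo) with h | h
    · rw [ZMod.χ₄_nat_one_mod_four h, one_mul, jacobiSym.quadratic_reciprocity_one_mod_four h hko]
    · rw [ZMod.χ₄_nat_three_mod_four h, jacobiSym.quadratic_reciprocity_three_mod_four h hk3]
      ring

theorem exists_isKroneckerChar_four_mul {m : ℤ} (hm : m ≠ 0) :
    ∃ χ : DirichletCharacter ℂ (4 * m).natAbs, IsKroneckerChar (4 * m) χ := by
  classical
  have hk : (4 * m).natAbs = 4 * m.natAbs := by rw [Int.natAbs_mul]; rfl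
  set k := (4 * m).natAbs
  have : NeZero k := ⟨by have := Int.natAbs_ne_zero.mpr hm; omega⟩
  have hodd : ∀ a : ZMod k, IsUnit a → Odd a.val := by
    intro a ha
    rw [← ZMod.natCast_zmod_val a, ZMod.isUnit_iff_coprime] at ha
    have : Nat.Coprime a.val 2 := Nat.Coprime.coprime_dvd_right ⟨2 * m.natAbs, by omega⟩ ha
    exact Nat.coprime_two_right.mp this
  have hval : ∀ n : ℕ, Odd n → jacobiSym m (n % k) = jacobiSym m n := by
    intro n hn
    rw [jacobiSym.mod_right m hn, hk]
  refine ⟨⟨⟨⟨fun a ↦ if IsUnit a then ((jacobiSym m a.val : ℤ) : ℂ) else 0, ?_⟩, ?_⟩, ?_⟩, ?_⟩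
  · rw [if_pos isUnit_one, ZMod.val_one_eq_one_mod, hval 1 odd_one]
    simp
  · intro a b
    by_cases ha : IsUnit a
    · by_cases hb : IsUnit b
      · simp only [ha, hb, IsUnit.mul_iff, and_self, if_true]
        have ha' := hodd a ha
        have hb' := hodd b hb
        rw [ZMod.val_mul, hval _ (ha'.mul hb'),
          jacobiSym.mul_right' m (by rintro h; simp [h] at ha') (by rintro h; simp [h] at hb')]
        push_cast; rfl
      · simp [hb, IsUnit.mul_iff]
    · simp [ha, IsUnit.mul_iff]
  · intro a ha
    simp [ha]
  · intro p hp hp2 hd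
    have : Fact p.Prime := ⟨hp⟩
    have hpo := hp.odd_of_ne_two hp2
    have hu : IsUnit (p : ZMod k) := by
      rw [ZMod.isUnit_iff_coprime, hp.coprime_iff_not_dvd]
      exact fun h ↦ hd (Int.natCast_dvd.mpr h)
    change (if IsUnit (p : ZMod k) then ((jacobiSym m (p : ZMod k).val : ℤ) : ℂ) else 0) = _
    rw [if_pos hu, ZMod.val_natCast, hval _ hpo, jacobiSym.legendreSym.to_jacobiSym,
      jacobiSym.mul_left, jacobiSym.at_four hpo, one_mul]

theorem IsFundamentalDiscriminant.exists_isKroneckerChar {D : ℤ} (h : IsFundamentalDiscriminant D)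
    (hD : D < 0) : ∃ χ : DirichletCharacter ℂ D.natAbs, IsKroneckerChar D χ := by
  rcases h with ⟨_, ⟨h4, _⟩ | ⟨m, rfl, hm, _⟩⟩
  · exact exists_isKroneckerChar_of_mod_four_eq_one hD h4
  · exact exists_isKroneckerChar_four_mul hm.ne_zero

open Set MeasureTheory Filter Topology Asymptotics Complex in
theorem differentiableAt_integral_Ioi_one_mul_cpow {f : ℝ → ℂ} (hf : Measurable f) {B : ℝ}
    (hB : ∀ t, ‖f t‖ ≤ B) {s : ℂ} (hs : 0 < s.re) :
    DifferentiableAt ℂ (fun s : ℂ ↦ ∫ t in Ioi (1 : ℝ), f t * (t : ℂ) ^ (-(s + 1))) s := by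
  set g : ℝ → ℂ := (Ioi (1 : ℝ)).indicator f with hg
  have hgm : Measurable g := hf.indicator measurableSet_Ioi
  have hgB : ∀ t, ‖g t‖ ≤ B := fun t ↦ (norm_indicator_le_norm_self f t).trans (hB t)
  have key : (fun s : ℂ ↦ ∫ t in Ioi (1 : ℝ), f t * (t : ℂ) ^ (-(s + 1))) =
      fun s ↦ mellin g (-s) := by
    ext s
    rw [mellin, ← integral_indicator measurableSet_Ioi, ← integral_indicator measurableSet_Ioi]
    congr 1
    ext t
    by_cases ht : 1 < t
    · rw [indicator_of_mem (mem_Ioi.2 ht), indicator_of_mem (mem_Ioi.2 (by linarith)), hg,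
        indicator_of_mem (mem_Ioi.2 ht), smul_eq_mul, mul_comm]
      congr 2; ring
    · rw [indicator_of_notMem (by simpa using ht)]
      by_cases h0 : 0 < t
      · rw [indicator_of_mem (mem_Ioi.2 h0), hg, indicator_of_notMem (by simpa using ht), smul_zero]
      · rw [indicator_of_notMem (by simpa using h0)]
  rw [key]
  have h1 : DifferentiableAt ℂ (mellin g) (-s) := by
    refine mellin_differentiableAt_of_isBigO_rpow (a := 0) (b := -s.re - 1) ?_ ?_ (by simpa) ?_
      (by simp)
    · refine LocallyIntegrable.locallyIntegrableOn ?_ _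
      refine (locallyIntegrable_const (B : ℝ)).mono hgm.aestronglyMeasurable ?_
      exact Eventually.of_forall fun t ↦ (hgB t).trans (le_abs_self B)
    · refine IsBigO.of_bound B (Eventually.of_forall fun t ↦ ?_)
      simpa using hgB t
    · refine IsBigO.of_bound 0 ?_
      filter_upwards [nhdsWithin_le_nhds (Iio_mem_nhds (zero_lt_one' ℝ))] with t ht
      rw [hg, indicator_of_notMem (by simpa using (le_of_lt ht))]
      simp
  exact DifferentiableAt.comp (f := fun s : ℂ ↦ -s) s h1 differentiable_neg.differentiableAt

open Set MeasureTheory Complex in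
theorem norm_integral_Ioi_one_mul_cpow_le {f : ℝ → ℂ} {B : ℝ}
    (hB : ∀ t, ‖f t‖ ≤ B) {s : ℂ} (hs : 0 < s.re) :
    ‖∫ t in Ioi (1 : ℝ), f t * (t : ℂ) ^ (-(s + 1))‖ ≤ B / s.re := by
  have h := integrableOn_Ioi_rpow_of_lt (a := -(s.re + 1)) (by linarith) (zero_lt_one' ℝ)
  calc _ ≤ ∫ t in Ioi (1 : ℝ), B * t ^ (-(s.re + 1)) := by
        refine norm_integral_le_of_norm_le (h.const_mul B) ?_
        filter_upwards [ae_restrict_mem measurableSet_Ioi] with t ht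
        have ht0 : (0 : ℝ) < t := by linarith [mem_Ioi.1 ht]
        rw [norm_mul, norm_cpow_eq_rpow_re_of_pos ht0]
        simp only [neg_re, add_re, one_re]
        gcongr
        exact hB t
    _ = B / s.re := by
        rw [integral_const_mul, integral_Ioi_rpow_of_lt (by linarith) (by norm_num)]
        simp; field_simp

open Set MeasureTheory Filter Topology Complex in
theorem eq_mul_integral_Ioi_one_of_one_lt_re {f : ℝ → ℂ} (hf : Measurable f) {B : ℝ}
    (hB : ∀ t, ‖f t‖ ≤ B) {H p : ℂ → ℂ} (hH : Differentiable ℂ H) (hp : Differentiable ℂ p)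
    (h : ∀ s : ℂ, 1 < s.re → H s = p s * ∫ t in Ioi (1 : ℝ), f t * (t : ℂ) ^ (-(s + 1)))
    {s : ℂ} (hs : 0 < s.re) :
    H s = p s * ∫ t in Ioi (1 : ℝ), f t * (t : ℂ) ^ (-(s + 1)) := by
  have hU : IsOpen {s : ℂ | 0 < s.re} := isOpen_lt continuous_const continuous_re
  have hc : Convex ℝ {s : ℂ | 0 < s.re} := convex_halfSpace_re_gt 0
  have hd : DifferentiableOn ℂ (fun s ↦ p s * ∫ t in Ioi (1 : ℝ), f t * (t : ℂ) ^ (-(s + 1)))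
      {s : ℂ | 0 < s.re} := fun z hz ↦
    ((hp z).mul (differentiableAt_integral_Ioi_one_mul_cpow hf hB hz)).differentiableWithinAt
  refine (hH.differentiableOn.analyticOnNhd hU).eqOn_of_preconnected_of_eventuallyEq
    (hd.analyticOnNhd hU) hc.isPreconnected (z₀ := 2) (by simp) ?_ hs
  filter_upwards [(isOpen_lt continuous_const continuous_re).mem_nhds
    (show (2 : ℂ) ∈ {s : ℂ | 1 < s.re} by simp)] with z hz using h z hz

open Set MeasureTheory in
theorem DirichletCharacter.LFunction_eq_mul_integral {N : ℕ} [NeZero N] {χ : DirichletCharacter ℂ N}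
    (hχ : χ ≠ 1) {s : ℂ} (hs : 0 < s.re) :
    χ.LFunction s =
      s * ∫ t in Ioi (1 : ℝ), (∑ n ∈ Finset.range (⌊t⌋₊ + 1), χ n) * (t : ℂ) ^ (-(s + 1)) := by
  have hN : N ≠ 1 := by
    rintro rfl
    exact hχ (DirichletCharacter.level_one χ)
  have h0 : χ ((0 : ℕ) : ZMod N) = 0 := by
    have := Fact.mk (show 1 < N by have := NeZero.ne N; omega)
    simpa using MulChar.map_zero χ
  have hS : ∀ m : ℕ, ∑ k ∈ Finset.Icc 1 m, χ k = ∑ n ∈ Finset.range (m + 1), χ n := by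
    intro m
    rw [Finset.range_eq_Ico, Finset.sum_eq_sum_Ico_succ_bot (by omega), h0, zero_add]
    rfl
  have hb := norm_sum_range_le hχ
  refine eq_mul_integral_Ioi_one_of_one_lt_re (H := χ.LFunction) (p := id)
    (B := 2 * √N * (1 + Real.log N))
    ?_ (fun t ↦ hb _) (differentiable_LFunction hχ) differentiable_id (fun s hs ↦ ?_) hs
  · exact (measurable_from_top (f := fun m : ℕ ↦ ∑ n ∈ Finset.range (m + 1), χ n)).comp
      Nat.measurable_floor
  · rw [LFunction_eq_LSeries χ hs, LSeries_eq_mul_integral _ le_rfl (by linarith)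
      (LSeriesSummable_of_one_lt_re χ hs)]
    · simp_rw [hS]; rfl
    · refine Asymptotics.IsBigO.of_bound (2 * √N * (1 + Real.log N)) (.of_forall fun n ↦ ?_)
      rw [hS]
      simpa using hb (n + 1)

theorem DirichletCharacter.norm_LFunction_le_of_pos_re {N : ℕ} [NeZero N]
    {χ : DirichletCharacter ℂ N} (hχ : χ ≠ 1) {P : ℝ}
    (hP : ∀ m : ℕ, ‖∑ n ∈ Finset.range m, χ n‖ ≤ P) {s : ℂ} (hs : 0 < s.re) :
    ‖χ.LFunction s‖ ≤ P * (‖s‖ / s.re) := by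
  rw [LFunction_eq_mul_integral hχ hs, norm_mul]
  have := norm_integral_Ioi_one_mul_cpow_le
    (f := fun t : ℝ ↦ ∑ n ∈ Finset.range (⌊t⌋₊ + 1), χ n) (fun t ↦ hP _) hs
  calc _ ≤ ‖s‖ * (P / s.re) := by gcongr
    _ = _ := by ring

open Set MeasureTheory in
theorem riemannZeta₁_eq_sub_mul_integral_fract {s : ℂ} (hs : 0 < s.re) :
    riemannZeta₁ s =
      s - s * (s - 1) * ∫ t in Ioi (1 : ℝ), ((Int.fract t : ℝ) : ℂ) * (t : ℂ) ^ (-(s + 1)) := by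
  have hm : Measurable fun t : ℝ ↦ ((Int.fract t : ℝ) : ℂ) :=
    Complex.measurable_ofReal.comp measurable_fract
  have hb : ∀ t : ℝ, ‖((Int.fract t : ℝ) : ℂ)‖ ≤ 1 := fun t ↦ by
    rw [Complex.norm_real, Real.norm_of_nonneg (Int.fract_nonneg t)]
    exact (Int.fract_lt_one t).le
  have := eq_mul_integral_Ioi_one_of_one_lt_re hm hb (H := fun s ↦ s - riemannZeta₁ s)
    (p := fun s ↦ s * (s - 1)) (by fun_prop) (by fun_prop) (fun s hs ↦ ?_) hs
  · linear_combination -this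
  have hs1 : s ≠ 1 := by rintro rfl; simp at hs
  have hs1' : s - 1 ≠ 0 := sub_ne_zero.2 hs1
  have hsum : LSeriesSummable (1 : ℕ → ℂ) s := LSeriesSummable_one_iff.2 hs
  have hz : riemannZeta s = s * ∫ t in Ioi (1 : ℝ), (⌊t⌋₊ : ℂ) * (t : ℂ) ^ (-(s + 1)) := by
    rw [← LSeries_one_eq_riemannZeta hs,
      LSeries_eq_mul_integral 1 (r := 1) zero_le_one hs hsum]
    · simp
    · refine Asymptotics.IsBigO.of_bound 1 (.of_forall fun n ↦ ?_)
      simp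
  have hi1 : IntegrableOn (fun t : ℝ ↦ (t : ℂ) ^ (-s)) (Ioi 1) :=
    integrableOn_Ioi_cpow_of_lt (by simpa using hs) one_pos
  have hi2 : IntegrableOn (fun t : ℝ ↦ ((Int.fract t : ℝ) : ℂ) * (t : ℂ) ^ (-(s + 1))) (Ioi 1) := by
    refine (integrableOn_Ioi_cpow_of_lt (a := -(s + 1)) ?_ one_pos).bdd_mul
      (c := 1) hm.aestronglyMeasurable (.of_forall hb)
    simp; linarith
  have hfl : ∫ t in Ioi (1 : ℝ), (⌊t⌋₊ : ℂ) * (t : ℂ) ^ (-(s + 1)) =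
      1 / (s - 1) - ∫ t in Ioi (1 : ℝ), ((Int.fract t : ℝ) : ℂ) * (t : ℂ) ^ (-(s + 1)) := by
    have : 1 / (s - 1) = ∫ t in Ioi (1 : ℝ), (t : ℂ) ^ (-s) := by
      rw [integral_Ioi_cpow_of_lt (by simpa using hs) one_pos]
      have : -s + 1 ≠ 0 := by intro h; apply hs1'; linear_combination -h
      rw [Complex.ofReal_one, Complex.one_cpow]
      field_simp; ring
    rw [this, ← integral_sub hi1 hi2]
    refine setIntegral_congr_fun measurableSet_Ioi fun t ht ↦ ?_
    have ht0 : (0 : ℝ) < t := by linarith [mem_Ioi.1 ht]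
    have h1 : ((⌊t⌋₊ : ℝ) : ℂ) = t - (Int.fract t : ℝ) := by
      rw [← Complex.ofReal_sub, Int.self_sub_fract, natCast_floor_eq_intCast_floor ht0.le]
    have h2 : (t : ℂ) ^ (-s) = t * (t : ℂ) ^ (-(s + 1)) := by
      rw [show -s = 1 + -(s + 1) by ring, Complex.cpow_add _ _ (by exact_mod_cast ht0.ne'),
        Complex.cpow_one]
    simp only [h2]
    rw [← Complex.ofReal_natCast, h1]; ring
  have h3 : riemannZeta₁ s = (s - 1) * riemannZeta s := by
    rw [riemannZeta_eq_inv_sub_mul hs1]; field_simp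
  rw [h3, hz, hfl]; field_simp; ring

open Set MeasureTheory in
theorem norm_riemannZeta₁_sub_le {s : ℂ} (hs : 0 < s.re) :
    ‖riemannZeta₁ s - 1 - (s - 1) / 2‖ ≤ ‖s - 1‖ * (‖s‖ / s.re / 2) := by
  have hm : Measurable fun t : ℝ ↦ ((Int.fract t : ℝ) : ℂ) :=
    Complex.measurable_ofReal.comp measurable_fract
  have hb : ∀ t : ℝ, ‖((Int.fract t : ℝ) - 1 / 2 : ℂ)‖ ≤ 1 / 2 := fun t ↦ by
    have h : ((Int.fract t : ℝ) - 1 / 2 : ℂ) = ((Int.fract t - 1 / 2 : ℝ) : ℂ) := by push_cast; ring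
    rw [h, Complex.norm_real, Real.norm_eq_abs, abs_le]
    constructor <;> linarith [Int.fract_nonneg t, Int.fract_lt_one t]
  have hi1 : IntegrableOn (fun t : ℝ ↦ (t : ℂ) ^ (-(s + 1))) (Ioi 1) :=
    integrableOn_Ioi_cpow_of_lt (by simp; linarith) one_pos
  have hi2 : IntegrableOn (fun t : ℝ ↦ ((Int.fract t : ℝ) : ℂ) * (t : ℂ) ^ (-(s + 1))) (Ioi 1) := by
    refine hi1.bdd_mul (c := 1) hm.aestronglyMeasurable (.of_forall fun t ↦ ?_)
    rw [Complex.norm_real, Real.norm_of_nonneg (Int.fract_nonneg t)]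
    exact (Int.fract_lt_one t).le
  have hs0 : s ≠ 0 := by rintro rfl; simp at hs
  have hJ : ∫ t in Ioi (1 : ℝ), (t : ℂ) ^ (-(s + 1)) = 1 / s := by
    rw [integral_Ioi_cpow_of_lt (by simp; linarith) one_pos, Complex.ofReal_one, Complex.one_cpow]
    rw [show -(s + 1) + 1 = -s by ring]; field_simp
  have key : riemannZeta₁ s - 1 - (s - 1) / 2 = -(s - 1) * (s *
      ∫ t in Ioi (1 : ℝ), ((Int.fract t : ℝ) - 1 / 2 : ℂ) * (t : ℂ) ^ (-(s + 1))) := by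
    simp_rw [sub_mul]
    rw [integral_sub hi2 (hi1.const_mul _), integral_const_mul, hJ,
      riemannZeta₁_eq_sub_mul_integral_fract hs]
    field_simp; ring
  rw [key, norm_mul, norm_neg, norm_mul]
  calc _ ≤ ‖s - 1‖ * (‖s‖ * (1 / 2 / s.re)) := by
        gcongr
        exact norm_integral_Ioi_one_mul_cpow_le hb hs
    _ = _ := by ring

open Set MeasureTheory in
theorem exists_riemannZeta₁_ofReal_eq {σ : ℝ} (h0 : 0 < σ) (h1 : σ ≤ 1) :
    ∃ r : ℝ, 0 < r ∧ riemannZeta₁ σ = r := by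
  refine ⟨σ + σ * (1 - σ) * ∫ t in Ioi (1 : ℝ), Int.fract t * t ^ (-(σ + 1)), ?_, ?_⟩
  · have : 0 ≤ ∫ t in Ioi (1 : ℝ), Int.fract t * t ^ (-(σ + 1)) := by
      refine setIntegral_nonneg measurableSet_Ioi fun t ht ↦ ?_
      exact mul_nonneg (Int.fract_nonneg t) (Real.rpow_nonneg (by linarith [mem_Ioi.1 ht]) _)
    have := mul_nonneg (mul_nonneg h0.le (by linarith : 0 ≤ 1 - σ)) this
    linarith
  · rw [riemannZeta₁_eq_sub_mul_integral_fract (by simpa using h0)]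
    push_cast [← integral_ofReal]
    have : ∫ t in Ioi (1 : ℝ), ((Int.fract t : ℝ) : ℂ) * (t : ℂ) ^ (-(σ + 1 : ℂ)) =
        ((∫ t in Ioi (1 : ℝ), Int.fract t * t ^ (-(σ + 1)) : ℝ) : ℂ) := by
      rw [← integral_complex_ofReal]
      refine setIntegral_congr_fun measurableSet_Ioi fun t ht ↦ ?_
      have ht0 : (0 : ℝ) ≤ t := by linarith [mem_Ioi.1 ht]
      rw [Complex.ofReal_mul, Complex.ofReal_cpow ht0]; push_cast; rfl
    rw [this]; ring

open Set MeasureTheory in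
theorem DirichletCharacter.norm_LFunction_one_le {N : ℕ} [NeZero N]
    {χ : DirichletCharacter ℂ N} (hχ : χ ≠ 1) {P : ℝ} (hP1 : 1 ≤ P)
    (hP : ∀ m : ℕ, ‖∑ n ∈ Finset.range m, χ n‖ ≤ P) :
    ‖χ.LFunction 1‖ ≤ 1 + Real.log P := by
  have hN : N ≠ 1 := by
    rintro rfl
    exact hχ (DirichletCharacter.level_one χ)
  have h0 : χ ((0 : ℕ) : ZMod N) = 0 := by
    have := Fact.mk (show 1 < N by have := NeZero.ne N; omega)
    simpa using MulChar.map_zero χ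
  have hS : ∀ m : ℕ, ‖∑ n ∈ Finset.range (m + 1), χ n‖ ≤ m := by
    intro m
    rw [Finset.sum_range_succ', h0, add_zero]
    refine (norm_sum_le _ _).trans ?_
    simpa using Finset.sum_le_card_nsmul (Finset.range m)
      (fun k ↦ ‖χ ((k + 1 : ℕ) : ZMod N)‖) 1 fun k _ ↦ DirichletCharacter.norm_le_one χ _
  rw [LFunction_eq_mul_integral hχ (by simp), one_mul]
  set g : ℝ → ℝ := fun t ↦ min t P * t ^ (-2 : ℝ) with hg
  have hi1 : IntegrableOn g (Ioc 1 P) := by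
    refine (ContinuousOn.integrableOn_Icc ?_).mono_set Ioc_subset_Icc_self
    refine ContinuousOn.mul (by fun_prop) ?_
    exact continuousOn_id.rpow_const fun t ht ↦ Or.inl (by simp only [id]; linarith [ht.1])
  have hi2 : IntegrableOn g (Ioi P) := by
    have h := (integrableOn_Ioi_rpow_of_lt (a := -2) (by norm_num)
      (by linarith : (0 : ℝ) < P)).const_mul P
    refine IntegrableOn.congr_fun h (fun t ht ↦ ?_) measurableSet_Ioi
    simp [hg, min_eq_right (le_of_lt (mem_Ioi.1 ht))]
  have hi : IntegrableOn g (Ioi 1) := by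
    rw [← Ioc_union_Ioi_eq_Ioi hP1]; exact hi1.union hi2
  calc _ ≤ ∫ t in Ioi (1 : ℝ), g t := by
        refine norm_integral_le_of_norm_le hi ?_
        filter_upwards [ae_restrict_mem measurableSet_Ioi] with t ht
        have ht0 : (0 : ℝ) < t := by linarith [mem_Ioi.1 ht]
        rw [norm_mul, Complex.norm_cpow_eq_rpow_re_of_pos ht0, hg]
        simp only [Complex.neg_re, Complex.add_re, Complex.one_re]
        norm_num only
        gcongr
        exact le_min ((hS _).trans (Nat.floor_le ht0.le)) (hP _)
    _ = (∫ t in Ioc 1 P, g t) + ∫ t in Ioi P, g t := by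
        rw [← Ioc_union_Ioi_eq_Ioi hP1,
          setIntegral_union (Ioc_disjoint_Ioi le_rfl) measurableSet_Ioi hi1 hi2]
    _ = Real.log P + 1 := by
        congr 1
        · have : ∫ t in Ioc 1 P, g t = ∫ t in Ioc 1 P, t⁻¹ := by
            refine setIntegral_congr_fun measurableSet_Ioc fun t ht ↦ ?_
            have ht0 : (0 : ℝ) < t := by linarith [ht.1]
            simp only [hg, min_eq_left ht.2]
            rw [show (-2 : ℝ) = -1 + -1 by norm_num, Real.rpow_add ht0, Real.rpow_neg_one]
            field_simp
          rw [this, ← intervalIntegral.integral_of_le hP1,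
            integral_inv_of_pos one_pos (by linarith)]
          simp
        · have : ∫ t in Ioi P, g t = ∫ t in Ioi P, P * t ^ (-2 : ℝ) := by
            refine setIntegral_congr_fun measurableSet_Ioi fun t ht ↦ ?_
            simp [hg, min_eq_right (le_of_lt (mem_Ioi.1 ht))]
          rw [this, integral_const_mul, integral_Ioi_rpow_of_lt (by norm_num) (by linarith)]
          norm_num
          rw [Real.rpow_neg_one]; field_simp
    _ = _ := add_comm _ _

theorem MulChar.conj_apply_of_sq_eq_one {R : Type*} [CommMonoid R] {χ : MulChar R ℂ} (h : χ ^ 2 = 1)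
    (a : R) : (starRingEnd ℂ) (χ a) = χ a := by
  rcases MulChar.isQuadratic_iff_sq_eq_one.2 h a with h | h | h <;> simp [h]

open Set MeasureTheory in
theorem DirichletCharacter.conj_LFunction_ofReal {N : ℕ} [NeZero N]
    {χ : DirichletCharacter ℂ N} (hχ : χ ≠ 1) (h2 : χ ^ 2 = 1) {σ : ℝ} (h0 : 0 < σ) :
    (starRingEnd ℂ) (χ.LFunction σ) = χ.LFunction σ := by
  rw [LFunction_eq_mul_integral hχ (by simpa using h0), map_mul, ← integral_conj,
    Complex.conj_ofReal]
  congr 1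
  refine setIntegral_congr_fun measurableSet_Ioi fun t ht ↦ ?_
  have ht0 : (0 : ℝ) ≤ t := by linarith [mem_Ioi.1 ht]
  have : (t : ℂ) ^ (-(σ + 1 : ℂ)) = ((t ^ (-(σ + 1)) : ℝ) : ℂ) := by
    rw [Complex.ofReal_cpow ht0]; push_cast; rfl
  simp only [this, map_mul, map_sum, Complex.conj_ofReal, MulChar.conj_apply_of_sq_eq_one h2]

open Filter in
theorem DirichletCharacter.LFunction_ofReal_re_pos_of_ne_zero {N : ℕ} [NeZero N]
    {χ : DirichletCharacter ℂ N} (hχ : χ ≠ 1) (h2 : χ ^ 2 = 1) {σ : ℝ} (h0 : 0 < σ)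
    (h : ∀ x : ℝ, σ ≤ x → x < 1 → χ.LFunction x ≠ 0) : 0 < (χ.LFunction σ).re := by
  set g : ℝ → ℝ := fun x ↦ (χ.LFunction x).re with hg
  have hgc : Continuous g :=
    Complex.continuous_re.comp ((differentiable_LFunction hχ).continuous.comp
      Complex.continuous_ofReal)
  have hreal : ∀ x : ℝ, 0 < x → χ.LFunction x = g x := fun x hx ↦
    (Complex.conj_eq_iff_re.1 (conj_LFunction_ofReal hχ h2 hx)).symm
  have hne : ∀ x, σ ≤ x → g x ≠ 0 := by
    intro x hx hgx
    have h3 := hreal x (h0.trans_le hx)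
    rw [hgx, Complex.ofReal_zero] at h3
    rcases lt_or_ge x 1 with h1 | h1
    · exact h x hx h1 h3
    · exact LFunction_ne_zero_of_one_le_re χ (Or.inl hχ) (by simpa using h1) h3
  have hlim : Tendsto (fun x : ℝ ↦ χ.LFunction x) atTop (nhds 1) := by
    have h4 := LSeries.tendsto_atTop (f := fun n ↦ χ n)
      (lt_of_le_of_lt (b := ((1 : ℝ) : EReal))
        (LSeries.abscissaOfAbsConv_le_of_forall_lt_LSeriesSummable
        fun y hy ↦ LSeriesSummable_of_one_lt_re χ (by simpa using hy)) (EReal.coe_lt_top 1))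
    simp only [Nat.cast_one, map_one] at h4
    refine h4.congr' ?_
    filter_upwards [eventually_gt_atTop 1] with x hx
    rw [LFunction_eq_LSeries χ (by simpa using hx)]
  have hlim' : Tendsto g atTop (nhds 1) := by
    rw [← Complex.one_re]
    exact (Complex.continuous_re.tendsto 1).comp hlim
  obtain ⟨x, hx1, hx2⟩ := ((hlim'.eventually (lt_mem_nhds one_pos)).and
    (eventually_ge_atTop σ)).exists
  by_contra hcon
  obtain ⟨y, hy, hy0⟩ := intermediate_value_Icc hx2 hgc.continuousOn
    (⟨not_lt.1 hcon, hx1.le⟩ : (0 : ℝ) ∈ Set.Icc (g σ) (g x))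
  exact hne y hy.1 hy0

theorem LSeries.term_iterate_logMul (f : ℕ → ℂ) (m : ℕ) (s : ℂ) (n : ℕ) :
    LSeries.term (LSeries.logMul^[m] f) s n = (Real.log n : ℂ) ^ m * LSeries.term f s n := by
  induction m with
  | zero => simp
  | succ m ih =>
    rw [Function.iterate_succ_apply']
    rcases eq_or_ne n 0 with rfl | hn
    · simp
    · rw [LSeries.term_of_ne_zero hn] at ih ⊢
      rw [LSeries.logMul, mul_div_assoc, ih, pow_succ, Complex.natCast_log]
      ring

open scoped Topology in
open Metric LSeries in
/-- Taylor coefficients, at the point `6`, of an `L`-series with nonnegative coefficients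
after removal of its possible simple pole at `1`. -/
theorem exists_taylor_coeff_LSeries {b : ℕ → ℝ} (hb : ∀ n, 0 ≤ b n)
    (hab : abscissaOfAbsConv (fun n ↦ (b n : ℂ)) ≤ 1) {H : ℂ → ℂ} (hH : Differentiable ℂ H)
    (hHb : ∀ s : ℂ, 1 < s.re → H s = (s - 1) * LSeries (fun n ↦ (b n : ℂ)) s) {l : ℝ}
    (hl : H 1 = l) {B R : ℝ} (hR : 5 < R)
    (hB : ∀ s : ℂ, ‖s - 6‖ = R → ‖H s - l‖ ≤ B * ‖s - 1‖) :
    ∃ g : ℕ → ℝ, (∀ m, |g m| ≤ B / R ^ m) ∧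
      (∀ m (A : Finset ℕ), 0 ∉ A →
        ∑ n ∈ A, b n * (n : ℝ) ^ (-6 : ℝ) * Real.log n ^ m / m.factorial ≤ g m + l / 5 ^ (m + 1)) ∧
      ∀ δ : ℝ, 0 < δ → δ < R - 5 →
        H ((1 - δ : ℝ) : ℂ) = ((l - δ * ∑' m, g m * (5 + δ) ^ m : ℝ) : ℂ) := by
  set f : ℕ → ℂ := fun n ↦ (b n : ℂ) with hf
  set G : ℂ → ℂ := dslope H 1 with hG
  have hGd : Differentiable ℂ G := by
    rw [← differentiableOn_univ, hG, Complex.differentiableOn_dslope Filter.univ_mem]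
    exact hH.differentiableOn
  set a : ℕ → ℝ := fun m ↦ (∑' n : ℕ, Real.log n ^ m * (LSeries.term f 6 n).re) / m.factorial
  have h6 : abscissaOfAbsConv f < ((6 : ℂ).re : EReal) := by
    refine hab.trans_lt ?_
    norm_cast
  have hterm : ∀ n : ℕ, n ≠ 0 → term f 6 n = ((b n * (n : ℝ) ^ (-6 : ℝ) : ℝ) : ℂ) := by
    intro n hn
    rw [term_of_ne_zero hn, hf, div_eq_mul_inv, ← Complex.cpow_neg, Complex.ofReal_mul,
      Complex.ofReal_cpow (Nat.cast_nonneg n)]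
    norm_num
  have hterm' : ∀ n : ℕ, term f 6 n = ((term f 6 n).re : ℂ) := by
    intro n
    rcases eq_or_ne n 0 with rfl | hn
    · simp
    · rw [hterm n hn, Complex.ofReal_re]
  have hsumm : ∀ m : ℕ, Summable fun n : ℕ ↦ Real.log n ^ m * (term f 6 n).re := by
    intro m
    have h1 : LSeriesSummable (logMul^[m] f) 6 :=
      LSeriesSummable_of_abscissaOfAbsConv_lt_re (by rwa [absicssaOfAbsConv_logPowMul])
    rw [← Complex.summable_ofReal]
    refine h1.congr fun n ↦ ?_
    rw [term_iterate_logMul, hterm' n]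
    push_cast
    simp
  have hLS : ∀ m : ℕ, iteratedDeriv m (LSeries f) 6 = (-1) ^ m * (m.factorial * a m : ℝ) := by
    intro m
    rw [LSeries_iteratedDeriv m h6, LSeries]
    congr 1
    have : (m.factorial * a m : ℝ) = ∑' n : ℕ, Real.log n ^ m * (term f 6 n).re :=
      mul_div_cancel₀ _ (by positivity)
    rw [this, Complex.ofReal_tsum]
    refine tsum_congr fun n ↦ ?_
    rw [term_iterate_logMul, hterm' n]
    push_cast
    simp
  have hGe : G =ᶠ[𝓝 6] LSeries f - fun s ↦ (l : ℂ) • (s - 1)⁻¹ := by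
    filter_upwards [(isOpen_lt continuous_const Complex.continuous_re).mem_nhds
      (show (6 : ℂ) ∈ {s : ℂ | 1 < s.re} by simp)] with s hs
    have hs1 : s ≠ 1 := by rintro rfl; simp at hs
    have hs1' : s - 1 ≠ 0 := sub_ne_zero.2 hs1
    rw [hG, dslope_of_ne _ hs1, slope_def_field, hHb s hs, hl]
    simp only [Pi.sub_apply, smul_eq_mul]
    field_simp
  have hinv : ∀ m : ℕ, iteratedDeriv m (fun s : ℂ ↦ (l : ℂ) • (s - 1)⁻¹) 6 =
      (-1) ^ m * (m.factorial * (l / 5 ^ (m + 1)) : ℝ) := by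
    intro m
    have h1 : (fun s : ℂ ↦ (l : ℂ) • (s - 1)⁻¹) = (l : ℂ) • fun s : ℂ ↦ (s - 1)⁻¹ := rfl
    have h2 := iteratedDeriv_comp_sub_const m (fun s : ℂ ↦ s⁻¹) 1
    have h3 : ContDiffAt ℂ m (fun s : ℂ ↦ (s - 1)⁻¹) 6 :=
      ContDiffAt.inv (by fun_prop) (by norm_num)
    rw [h1, iteratedDeriv_const_smul h3, h2, iteratedDeriv_eq_iterate]
    simp only
    have h4 := iter_deriv_inv (𝕜 := ℂ) m (6 - 1)
    rw [h4, smul_eq_mul]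
    have h5 : (6 - 1 : ℂ) = 5 := by norm_num
    rw [h5, show (-1 - (m : ℤ)) = -((m + 1 : ℕ) : ℤ) by push_cast; ring, zpow_neg, zpow_natCast]
    push_cast
    ring
  have hGi : ∀ m : ℕ, iteratedDeriv m G 6 =
      (-1) ^ m * (m.factorial * (a m - l / 5 ^ (m + 1)) : ℝ) := by
    intro m
    have h3 : ContDiffAt ℂ m (fun s : ℂ ↦ (l : ℂ) • (s - 1)⁻¹) 6 :=
      (ContDiffAt.inv (f := fun s : ℂ ↦ s - 1) (n := m) (x := (6 : ℂ)) (by fun_prop)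
        (by norm_num)).const_smul (l : ℂ)
    have h4 : ContDiffAt ℂ m (LSeries f) 6 :=
      (LSeries_analyticOnNhd f 6 h6).contDiffAt
    rw [hGe.iteratedDeriv_eq, iteratedDeriv_sub h4 h3, hLS, hinv]
    push_cast; ring
  have hGB : ∀ s ∈ sphere (6 : ℂ) R, ‖G s‖ ≤ B := by
    intro s hs
    have hs' : ‖s - 6‖ = R := by simpa [dist_eq_norm] using hs
    have hs1 : s ≠ 1 := by rintro rfl; norm_num at hs'; linarith
    have hs1' : 0 < ‖s - 1‖ := norm_pos_iff.2 (sub_ne_zero.2 hs1)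
    rw [hG, dslope_of_ne _ hs1, slope_def_field, hl, norm_div, div_le_iff₀ hs1']
    exact hB s hs'
  refine ⟨fun m ↦ a m - l / 5 ^ (m + 1), fun m ↦ ?_, fun m A hA ↦ ?_, fun δ h0 hδ ↦ ?_⟩
  · have h1 := Complex.norm_iteratedDeriv_le_of_forall_mem_sphere_norm_le m (by linarith)
      hGd.diffContOnCl hGB
    rw [hGi, norm_mul, norm_pow, norm_neg, norm_one, one_pow, one_mul, Complex.norm_real,
      Real.norm_eq_abs, abs_mul, abs_of_nonneg (by positivity : (0 : ℝ) ≤ m.factorial),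
      mul_div_assoc] at h1
    exact le_of_mul_le_mul_left h1 (by positivity)
  · rw [sub_add_cancel, ← Finset.sum_div]
    refine div_le_div_of_nonneg_right ?_ (by positivity)
    calc _ = ∑ n ∈ A, Real.log n ^ m * (term f 6 n).re := by
          refine Finset.sum_congr rfl fun n hn ↦ ?_
          rw [hterm n (by rintro rfl; exact hA hn), Complex.ofReal_re]
          ring
      _ ≤ _ := by
          refine (hsumm m).sum_le_tsum _ fun n _ ↦ ?_
          rcases eq_or_ne n 0 with rfl | hn
          · simp
          · rw [hterm n hn, Complex.ofReal_re]
            have := hb n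
            have := Real.log_natCast_nonneg n
            positivity
  · have h1 := Complex.hasSum_taylorSeries_on_ball (c := 6) (r := R) (f := G)
      (z := ((1 - δ : ℝ) : ℂ))
      hGd.differentiableOn (by
        rw [mem_ball, dist_eq_norm]
        have : ((1 - δ : ℝ) : ℂ) - 6 = ((-(5 + δ) : ℝ) : ℂ) := by push_cast; ring
        rw [this, Complex.norm_real, norm_neg, Real.norm_of_nonneg (by linarith)]
        linarith)
    have h2 : G ((1 - δ : ℝ) : ℂ) =
        ((∑' m, (a m - l / 5 ^ (m + 1)) * (5 + δ) ^ m : ℝ) : ℂ) := by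
      rw [← h1.tsum_eq, Complex.ofReal_tsum]
      refine tsum_congr fun m ↦ ?_
      have h3 : ((1 - δ : ℝ) : ℂ) - 6 = (-1) * ((5 + δ : ℝ) : ℂ) := by push_cast; ring
      have h4 : (m.factorial : ℂ) ≠ 0 := by exact_mod_cast m.factorial_ne_zero
      have h5 : ((-1 : ℂ) ^ m) * (-1) ^ m = 1 := by rw [← mul_pow]; norm_num
      rw [hGi, h3, mul_pow, smul_eq_mul, smul_eq_mul, Complex.ofReal_mul, Complex.ofReal_mul,
        Complex.ofReal_pow, Complex.ofReal_natCast]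
      linear_combination (((5 + δ : ℝ) : ℂ) ^ m * ((a m - l / 5 ^ (m + 1) : ℝ) : ℂ)) *
        (h5 + ((-1 : ℂ) ^ m) * (-1) ^ m * inv_mul_cancel₀ h4)
    have h3 := sub_smul_dslope H 1 ((1 - δ : ℝ) : ℂ)
    rw [← hG, h2, hl, smul_eq_mul] at h3
    simp only [Complex.ofReal_sub, Complex.ofReal_mul, Complex.ofReal_one] at h3 ⊢
    linear_combination -h3

theorem Real.exp_sub_le_sum_range_pow_div_factorial {x : ℝ} (hx : 0 ≤ x) (M : ℕ) :
    Real.exp x - Real.exp (2 * x) / 2 ^ M ≤ ∑ m ∈ Finset.range M, x ^ m / m.factorial := by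
  have h1 : ∀ y : ℝ, HasSum (fun m : ℕ ↦ y ^ m / m.factorial) (Real.exp y) := fun y ↦ by
    rw [Real.exp_eq_exp_ℝ]; exact NormedSpace.expSeries_div_hasSum_exp y
  have h2 := ((h1 (2 * x)).div_const (2 ^ M)).sub (h1 x)
  have h3 := sum_le_hasSum (Finset.range M) (fun m hm ↦ ?_) h2
  · have h4 : (0 : ℝ) ≤ ∑ m ∈ Finset.range M, (2 * x) ^ m / m.factorial / 2 ^ M :=
      Finset.sum_nonneg fun m _ ↦ by positivity
    rw [Finset.sum_sub_distrib] at h3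
    linarith
  · have hm' : M ≤ m := by simpa using hm
    have h5 : (2 : ℝ) ^ M ≤ 2 ^ m := pow_le_pow_right₀ (by norm_num) hm'
    rw [sub_nonneg, le_div_iff₀ (by positivity), mul_pow, mul_comm, mul_div_assoc]
    gcongr

theorem sum_range_taylor_ge {b a : ℕ → ℝ} (hb2 : ∀ j, j ≠ 0 → 1 ≤ b (j ^ 2))
    (hA : ∀ m (A : Finset ℕ), 0 ∉ A →
      ∑ n ∈ A, b n * (n : ℝ) ^ (-6 : ℝ) * Real.log n ^ m / m.factorial ≤ a m)
    {u : ℝ} (hu : 5 ≤ u) (hu' : u ≤ 5.5) {M : ℕ} (hM : 100 ≤ M) :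
    1.625 ≤ ∑ m ∈ Finset.range M, a m * u ^ m := by
  set J := Finset.Icc 1 50 with hJ
  have hinj : Set.InjOn (fun j : ℕ ↦ j ^ 2) J := fun x _ y _ h ↦
    Nat.pow_left_injective (by norm_num) h
  have hJ0 : 0 ∉ J.image (fun j ↦ j ^ 2) := by simp [hJ]
  have h1 : ∀ m, ∑ j ∈ J, ((j : ℝ) ^ (-12 : ℝ) * (2 * Real.log j) ^ m / m.factorial) ≤ a m := by
    intro m
    refine le_trans ?_ (hA m _ hJ0)
    rw [Finset.sum_image hinj]
    refine Finset.sum_le_sum fun j hj ↦ ?_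
    have hj1 : 1 ≤ j := (Finset.mem_Icc.1 hj).1
    have hj0 : (0 : ℝ) < j := by exact_mod_cast hj1
    push_cast
    rw [Real.log_pow]
    push_cast
    have : ((j : ℝ) ^ 2) ^ (-6 : ℝ) = (j : ℝ) ^ (-12 : ℝ) := by
      rw [← Real.rpow_natCast, ← Real.rpow_mul hj0.le]; norm_num
    rw [this]
    have := Real.log_natCast_nonneg j
    have := hb2 j (by omega)
    refine div_le_div_of_nonneg_right ?_ (by positivity)
    refine mul_le_mul_of_nonneg_right ?_ (by positivity)
    exact le_mul_of_one_le_left (by positivity) this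
  have h2 : ∀ j ∈ J, (1 - 1 / 20000) * ((j : ℝ) ^ 2)⁻¹ ≤
      ∑ m ∈ Finset.range M, (j : ℝ) ^ (-12 : ℝ) * (2 * Real.log j) ^ m / m.factorial * u ^ m := by
    intro j hj
    have hj1 : 1 ≤ j := (Finset.mem_Icc.1 hj).1
    have hj50 : (j : ℝ) ≤ 50 := by exact_mod_cast (Finset.mem_Icc.1 hj).2
    have hj1' : (1 : ℝ) ≤ j := by exact_mod_cast hj1
    have hj0 : (0 : ℝ) < j := by linarith
    have hlog := Real.log_natCast_nonneg j
    have h3 := Real.exp_sub_le_sum_range_pow_div_factorial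
      (x := 2 * Real.log j * u) (by positivity) M
    have h4 : Real.exp (2 * Real.log j * u) = (j : ℝ) ^ (2 * u) := by
      rw [Real.rpow_def_of_pos hj0]; ring_nf
    have h5 : Real.exp (2 * (2 * Real.log j * u)) = (j : ℝ) ^ (2 * u) * (j : ℝ) ^ (2 * u) := by
      rw [← h4, ← Real.exp_add]; ring_nf
    have h6 : (j : ℝ) ^ (2 * u) ≤ 50 ^ 11 := by
      calc (j : ℝ) ^ (2 * u) ≤ (j : ℝ) ^ ((11 : ℕ) : ℝ) :=
            Real.rpow_le_rpow_of_exponent_le hj1' (by push_cast; linarith)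
        _ ≤ 50 ^ 11 := by rw [Real.rpow_natCast]; gcongr
    have h7 : (2 : ℝ) ^ 100 ≤ 2 ^ M := pow_le_pow_right₀ (by norm_num) hM
    have h8 : (j : ℝ) ^ (2 * u) / 2 ^ M ≤ 1 / 20000 := by
      rw [div_le_iff₀ (by positivity)]
      have : (50 : ℝ) ^ 11 ≤ 1 / 20000 * 2 ^ 100 := by norm_num
      linarith
    have h9 : ((j : ℝ) ^ 2)⁻¹ ≤ (j : ℝ) ^ (-12 : ℝ) * (j : ℝ) ^ (2 * u) := by
      rw [← Real.rpow_add hj0, ← Real.rpow_natCast, ← Real.rpow_neg hj0.le]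
      exact Real.rpow_le_rpow_of_exponent_le hj1' (by push_cast; linarith)
    calc (1 - 1 / 20000) * ((j : ℝ) ^ 2)⁻¹
        ≤ (1 - (j : ℝ) ^ (2 * u) / 2 ^ M) * ((j : ℝ) ^ (-12 : ℝ) * (j : ℝ) ^ (2 * u)) := by
          gcongr
          linarith
      _ = (j : ℝ) ^ (-12 : ℝ) *
          ((j : ℝ) ^ (2 * u) - (j : ℝ) ^ (2 * u) * (j : ℝ) ^ (2 * u) / 2 ^ M) := by
          ring
      _ ≤ (j : ℝ) ^ (-12 : ℝ) *
          ∑ m ∈ Finset.range M, (2 * Real.log j * u) ^ m / m.factorial := by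
          rw [h5, h4] at h3
          gcongr
      _ = _ := by
          rw [Finset.mul_sum]
          exact Finset.sum_congr rfl fun m _ ↦ by rw [mul_pow]; ring
  calc (1.625 : ℝ) ≤ ∑ j ∈ J, (1 - 1 / 20000) * ((j : ℝ) ^ 2)⁻¹ := by
        rw [hJ, ← Finset.mul_sum]
        norm_num [Finset.sum_Icc_succ_top]
    _ ≤ ∑ j ∈ J, ∑ m ∈ Finset.range M,
          (j : ℝ) ^ (-12 : ℝ) * (2 * Real.log j) ^ m / m.factorial * u ^ m := Finset.sum_le_sum h2
    _ = ∑ m ∈ Finset.range M,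
          (∑ j ∈ J, (j : ℝ) ^ (-12 : ℝ) * (2 * Real.log j) ^ m / m.factorial) * u ^ m := by
        rw [Finset.sum_comm]
        simp_rw [Finset.sum_mul]
    _ ≤ _ := by
        refine Finset.sum_le_sum fun m _ ↦ ?_
        have : 0 ≤ u := by linarith
        gcongr
        exact h1 m

section
variable {g : ℕ → ℝ} {l B R : ℝ}

theorem summable_mul_pow_of_abs_le_div_pow (hg : ∀ m, |g m| ≤ B / R ^ m) {u : ℝ} (hu : 0 ≤ u)
    (huR : u < R) : Summable fun m ↦ g m * u ^ m := by
  have hR : 0 < R := hu.trans_lt huR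
  refine Summable.of_norm_bounded (g := fun m ↦ B * (u / R) ^ m)
    ((summable_geometric_of_lt_one (by positivity) ((div_lt_one hR).2 huR)).mul_left B) fun m ↦ ?_
  rw [norm_mul, Real.norm_eq_abs, norm_pow, Real.norm_of_nonneg hu, div_pow]
  calc _ ≤ B / R ^ m * u ^ m := by gcongr; exact hg m
    _ = _ := by ring

theorem abs_add_le_div_pow (hg : ∀ m, |g m| ≤ B / R ^ m) (M : ℕ) (j : ℕ) :
    |g (j + M)| ≤ (B / R ^ M) / R ^ j := by
  refine (hg _).trans (le_of_eq ?_)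
  rw [pow_add, div_div, mul_comm]

theorem abs_tsum_mul_pow_le (hg : ∀ m, |g m| ≤ B / R ^ m) {u : ℝ} (hu : 0 ≤ u)
    (huR : u < R) : |∑' m, g m * u ^ m| ≤ B / (1 - u / R) := by
  have hR : 0 < R := hu.trans_lt huR
  rw [← Real.norm_eq_abs, div_eq_mul_inv]
  refine tsum_of_norm_bounded
    ((hasSum_geometric_of_lt_one (by positivity) ((div_lt_one hR).2 huR)).mul_left B) fun m ↦ ?_
  rw [norm_mul, Real.norm_eq_abs, norm_pow, Real.norm_of_nonneg hu, div_pow]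
  calc _ ≤ B / R ^ m * u ^ m := by gcongr; exact hg m
    _ = _ := by ring

theorem abs_tsum_mul_pow_sub_le (hg : ∀ m, |g m| ≤ B / R ^ m) {u v : ℝ} (hv : 0 ≤ v) (hvu : v ≤ u)
    (huR : u < R) :
    |∑' m, g m * u ^ m - ∑' m, g m * v ^ m| ≤ B / (R * (1 - u / R) ^ 2) * (u - v) := by
  have hu : 0 ≤ u := hv.trans hvu
  have hR : 0 < R := hu.trans_lt huR
  have hB : 0 ≤ B := by simpa using (abs_nonneg _).trans (hg 0)
  have hr : u / R < 1 := (div_lt_one hR).2 huR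
  rw [← (summable_mul_pow_of_abs_le_div_pow hg hu huR).tsum_sub
    (summable_mul_pow_of_abs_le_div_pow hg hv (hvu.trans_lt huR)), ← Real.norm_eq_abs]
  have h0 : HasSum (fun m : ℕ ↦ (m + 1 : ℝ) * (u / R) ^ m) (1 / (1 - u / R) ^ 2) := by
    simpa using hasSum_choose_mul_geometric_of_norm_lt_one 1
      (by rwa [Real.norm_of_nonneg (by positivity)] : ‖u / R‖ < 1)
  have h1 := h0.mul_left (B / R * (u - v))
  have h2 : HasSum (fun m : ℕ ↦ B / R ^ m * (m * u ^ (m - 1) * (u - v)))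
      (B / R * (u - v) * (1 / (1 - u / R) ^ 2)) := by
    rw [← hasSum_nat_add_iff' 1]
    simp only [Finset.sum_range_one, CharP.cast_eq_zero, zero_mul, mul_zero, sub_zero]
    refine h1.congr_fun fun m ↦ ?_
    simp only [Nat.add_sub_cancel, Nat.cast_add, Nat.cast_one]
    rw [pow_succ, div_pow]
    field_simp
  have h3 : B / (R * (1 - u / R) ^ 2) * (u - v) = B / R * (u - v) * (1 / (1 - u / R) ^ 2) := by
    field_simp
  rw [h3]
  refine tsum_of_norm_bounded h2 fun m ↦ ?_
  rw [← mul_sub, norm_mul, Real.norm_eq_abs]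
  gcongr
  · exact hg m
  · have := abs_pow_sub_pow_le u v m
    rw [abs_of_nonneg (sub_nonneg.2 hvu), abs_of_nonneg hu, abs_of_nonneg hv,
      max_eq_left hvu] at this
    rw [Real.norm_eq_abs]
    linarith

/-- Truncation of the Taylor expansion at `M` terms, with the polar part summed explicitly. -/
theorem sub_mul_tsum_eq_truncation (hg : ∀ m, |g m| ≤ B / R ^ m) (M : ℕ) {δ : ℝ} (hδ : 0 < δ)
    (hR : 5 + δ < R) :
    l - δ * ∑' m, g m * (5 + δ) ^ m =
      l * ((5 + δ) / 5) ^ M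
        - δ * ∑ m ∈ Finset.range M, (g m + l / 5 ^ (m + 1)) * (5 + δ) ^ m
        - δ * (5 + δ) ^ M * ∑' j, g (j + M) * (5 + δ) ^ j := by
  have hs := summable_mul_pow_of_abs_le_div_pow hg (by linarith : 0 ≤ 5 + δ) hR
  have h1 := hs.sum_add_tsum_nat_add M
  have h2 : ∑' j, g (j + M) * (5 + δ) ^ (j + M) = (5 + δ) ^ M * ∑' j, g (j + M) * (5 + δ) ^ j := by
    rw [← tsum_mul_left]
    exact tsum_congr fun j ↦ by rw [pow_add]; ring
  have h3 : ∑ m ∈ Finset.range M, (g m + l / 5 ^ (m + 1)) * (5 + δ) ^ m =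
      ∑ m ∈ Finset.range M, g m * (5 + δ) ^ m + l / δ * (((5 + δ) / 5) ^ M - 1) := by
    have h4 : ((5 + δ) / 5) ≠ 1 := by
      rw [Ne, div_eq_one_iff_eq (by norm_num)]; linarith
    have h5 := geom_sum_eq h4 M
    have h6 : (((5 + δ) / 5) ^ M - 1) = δ / 5 * ∑ i ∈ Finset.range M, ((5 + δ) / 5) ^ i := by
      rw [h5, show (5 + δ) / 5 - 1 = δ / 5 by ring]; field_simp
    rw [h6, Finset.mul_sum, Finset.mul_sum, ← Finset.sum_add_distrib]
    refine Finset.sum_congr rfl fun m _ ↦ ?_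
    rw [div_pow, pow_succ]; field_simp
  rw [← h1, h2, h3]
  field_simp; ring

theorem mul_le_mul_pow_of_nonneg (hg : ∀ m, |g m| ≤ B / R ^ m) (M : ℕ) {δ : ℝ} (hδ : 0 < δ)
    (hR : 5 + δ < R) (h : 0 ≤ l - δ * ∑' m, g m * (5 + δ) ^ m) :
    δ * (∑ m ∈ Finset.range M, (g m + l / 5 ^ (m + 1)) * (5 + δ) ^ m
      - B * ((5 + δ) / R) ^ M / (1 - (5 + δ) / R)) ≤ l * ((5 + δ) / 5) ^ M := by
  rw [sub_mul_tsum_eq_truncation hg M hδ hR] at h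
  have h1 := abs_tsum_mul_pow_le (abs_add_le_div_pow hg M) (by linarith : 0 ≤ 5 + δ) hR
  have h2 : -(B * ((5 + δ) / R) ^ M / (1 - (5 + δ) / R)) ≤
      (5 + δ) ^ M * ∑' j, g (j + M) * (5 + δ) ^ j := by
    calc _ = (5 + δ) ^ M * -(B / R ^ M / (1 - (5 + δ) / R)) := by rw [div_pow]; ring
      _ ≤ _ := by gcongr; exact (abs_le.1 h1).1
  have h3 := mul_le_mul_of_nonneg_left h2 hδ.le
  linarith

theorem le_mul_inv_pow_sub_mul_inv_pow {x y d : ℝ} {θ : ℝ} (hθ0 : 0 ≤ θ) (hθ : θ ≤ 1)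
    (hx : 0 ≤ x) (hxy : x ≤ y)
    (hyd : y ≤ d) {k : ℕ} (hk : (k - 1) * d ≤ 5 * θ) :
    5 * (1 - θ) / (5 + d) ^ (k + 1) * (y - x) ≤ y / (5 + y) ^ k - x / (5 + x) ^ k := by
  have hder : ∀ z : ℝ, 0 ≤ z → HasDerivAt (fun z : ℝ ↦ z / (5 + z) ^ k)
      ((5 - (k - 1) * z) / (5 + z) ^ (k + 1)) z := by
    intro z hz
    have h1 : HasDerivAt (fun z : ℝ ↦ (5 + z) ^ k) (k * (5 + z) ^ (k - 1) * 1) z :=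
      ((hasDerivAt_id z).const_add 5).pow k
    have h2 := (hasDerivAt_id z).div h1 (by positivity)
    refine h2.congr_deriv ?_
    have hz5 : 5 + z ≠ 0 := by positivity
    rcases k with _ | k
    · simp; field_simp
    · simp only [Nat.add_sub_cancel, id]
      push_cast
      field_simp
      ring
  refine Convex.mul_sub_le_image_sub_of_le_deriv (convex_Icc 0 d)
    (f := fun z : ℝ ↦ z / (5 + z) ^ k) (fun z hz ↦ (hder z hz.1).continuousAt.continuousWithinAt)
    (fun z hz ↦ (hder z ?_).differentiableAt.differentiableWithinAt) (fun z hz ↦ ?_)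
    x ⟨hx, hxy.trans hyd⟩ y ⟨hx.trans hxy, hyd⟩ hxy
  · rw [interior_Icc] at hz; exact hz.1.le
  · rw [interior_Icc] at hz
    have hz0 := hz.1
    rw [(hder z hz.1.le).deriv]
    have h3 : (k - 1) * z ≤ 5 * θ := by
      rcases k with _ | k
      · push_cast
        linarith
      · push_cast at hk ⊢
        have := mul_le_mul_of_nonneg_left hz.2.le (Nat.cast_nonneg (α := ℝ) k)
        linarith
    have h4 := hz.2
    have h5 : 0 ≤ 5 * (1 - θ) := by linarith
    calc 5 * (1 - θ) / (5 + d) ^ (k + 1) ≤ 5 * (1 - θ) / (5 + z) ^ (k + 1) := by gcongr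
      _ ≤ _ := by gcongr; linarith

theorem mul_le_sub_mul_tsum_of_eq_zero (hg : ∀ m, |g m| ≤ B / R ^ m)
    (ha : ∀ m, 0 ≤ g m + l / 5 ^ (m + 1)) (ha0 : 1 ≤ g 0 + l / 5) {M : ℕ} (hM : 1 ≤ M)
    {x y d θ : ℝ} (hθ0 : 0 ≤ θ) (hθ : θ ≤ 1) (hd : (M - 1) * d ≤ 5 * θ) (hdR : 5 + d < R)
    (hx : 0 < x) (hxy : x ≤ y) (hyd : y ≤ d)
    (hC : 0 ≤ 5 * (1 - θ) / (5 + d) ^ (M + 1) -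
      B / R ^ M * (1 / (1 - (5 + d) / R) + d / (R * (1 - (5 + d) / R) ^ 2)))
    (h : l - y * ∑' m, g m * (5 + y) ^ m = 0) :
    5 ^ M * (5 * (1 - θ) / (5 + d) ^ (M + 1) -
      B / R ^ M * (1 / (1 - (5 + d) / R) + d / (R * (1 - (5 + d) / R) ^ 2))) * (y - x) ≤
      l - x * ∑' m, g m * (5 + x) ^ m := by
  have hy : 0 < y := hx.trans_le hxy
  have hR : 0 < R := by linarith
  have hB : 0 ≤ B := by simpa using (abs_nonneg _).trans (hg 0)
  set C := 5 * (1 - θ) / (5 + d) ^ (M + 1) -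
      B / R ^ M * (1 / (1 - (5 + d) / R) + d / (R * (1 - (5 + d) / R) ^ 2)) with hCdef
  set T : ℝ → ℝ := fun z ↦ ∑' j, g (j + M) * (5 + z) ^ j with hT
  set W : ℝ → ℝ := fun z ↦
    ∑ m ∈ Finset.range M, (g m + l / 5 ^ (m + 1)) * (z / (5 + z) ^ (M - m)) + z * T z with hW
  have key : ∀ z, 0 < z → z ≤ d →
      l - z * ∑' m, g m * (5 + z) ^ m = ((5 + z) / 5) ^ M * (l - 5 ^ M * W z) := by
    intro z hz hzd
    rw [sub_mul_tsum_eq_truncation hg M hz (by linarith), hW, mul_sub, div_pow]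
    have h1 : z * ∑ m ∈ Finset.range M, (g m + l / 5 ^ (m + 1)) * (5 + z) ^ m =
        (5 + z) ^ M *
          ∑ m ∈ Finset.range M, (g m + l / 5 ^ (m + 1)) * (z / (5 + z) ^ (M - m)) := by
      rw [Finset.mul_sum, Finset.mul_sum]
      refine Finset.sum_congr rfl fun m hm ↦ ?_
      have hm' : m ≤ M := (Finset.mem_range.1 hm).le
      have h2 : (5 + z) ^ M = (5 + z) ^ m * (5 + z) ^ (M - m) := by
        rw [← pow_add, Nat.add_sub_cancel' hm']
      rw [h2]
      field_simp
    rw [h1]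
    field_simp
    ring
  have hr1 : (5 + d) / R < 1 := (div_lt_one hR).2 hdR
  have hr : 0 < 1 - (5 + d) / R := by linarith
  have hry : (5 + y) / R ≤ (5 + d) / R := by gcongr
  have hd0 : 0 < d := hy.trans_le hyd
  have hmain : (y - x) * (5 * (1 - θ) / (5 + d) ^ (M + 1)) ≤
      ∑ m ∈ Finset.range M, (g m + l / 5 ^ (m + 1)) * (y / (5 + y) ^ (M - m)) -
      ∑ m ∈ Finset.range M, (g m + l / 5 ^ (m + 1)) * (x / (5 + x) ^ (M - m)) := by
    rw [← Finset.sum_sub_distrib]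
    have hmono : ∀ m, 5 * (1 - θ) / (5 + d) ^ (M - m + 1) * (y - x) ≤
        y / (5 + y) ^ (M - m) - x / (5 + x) ^ (M - m) := fun m ↦ by
      refine le_mul_inv_pow_sub_mul_inv_pow hθ0 hθ hx.le hxy hyd (le_trans ?_ hd)
      have : ((M - m : ℕ) : ℝ) ≤ M := by exact_mod_cast Nat.sub_le M m
      gcongr
    have hnn : ∀ m, 0 ≤ 5 * (1 - θ) / (5 + d) ^ (M - m + 1) * (y - x) := fun m ↦ by
      have : 0 ≤ 1 - θ := by linarith
      have : 0 ≤ y - x := by linarith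
      positivity
    refine le_trans ?_ (Finset.single_le_sum (f := fun m ↦
      (g m + l / 5 ^ (m + 1)) * (y / (5 + y) ^ (M - m)) -
      (g m + l / 5 ^ (m + 1)) * (x / (5 + x) ^ (M - m))) (fun m _ ↦ ?_)
      (Finset.mem_range.2 hM))
    · have h1 := hmono 0
      have h2 := hnn 0
      rw [Nat.sub_zero] at h1 h2
      simp only [Nat.sub_zero, zero_add, pow_one]
      rw [← mul_sub]
      nlinarith
    · rw [← mul_sub]
      exact mul_nonneg (ha m) ((hnn m).trans (hmono m))
  have hg' := abs_add_le_div_pow hg M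
  have ht1 : |T y| ≤ B / R ^ M * (1 / (1 - (5 + d) / R)) := by
    refine (abs_tsum_mul_pow_le hg' (by linarith) (by linarith)).trans ?_
    rw [mul_one_div]
    gcongr
  have ht2 : |T y - T x| ≤ B / R ^ M * (1 / (R * (1 - (5 + d) / R) ^ 2)) * (y - x) := by
    refine (abs_tsum_mul_pow_sub_le hg' (by linarith) (by linarith) (by linarith)).trans ?_
    rw [mul_one_div, show 5 + y - (5 + x) = y - x by ring]
    have : 0 ≤ y - x := by linarith
    gcongr
  have hWC : C * (y - x) ≤ W y - W x := by
    have h1 : W y - W x = (∑ m ∈ Finset.range M, (g m + l / 5 ^ (m + 1)) * (y / (5 + y) ^ (M - m)) -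
        ∑ m ∈ Finset.range M, (g m + l / 5 ^ (m + 1)) * (x / (5 + x) ^ (M - m))) +
        ((y - x) * T y + x * (T y - T x)) := by
      simp only [hW]; ring
    have h2 : -((y - x) * (B / R ^ M * (1 / (1 - (5 + d) / R)))) ≤ (y - x) * T y := by
      rw [← mul_neg]
      have : 0 ≤ y - x := by linarith
      gcongr
      exact (abs_le.1 ht1).1
    have h3 : -(d * (B / R ^ M * (1 / (R * (1 - (5 + d) / R) ^ 2)) * (y - x))) ≤
        x * (T y - T x) := by
      calc _ ≤ -(x * |T y - T x|) := by
            refine neg_le_neg (mul_le_mul (hxy.trans hyd) ht2 (abs_nonneg _) hd0.le)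
        _ = x * -|T y - T x| := by ring
        _ ≤ _ := by gcongr; exact neg_abs_le _
    have h4 : C * (y - x) = (y - x) * (5 * (1 - θ) / (5 + d) ^ (M + 1)) +
        (-((y - x) * (B / R ^ M * (1 / (1 - (5 + d) / R)))) +
        -(d * (B / R ^ M * (1 / (R * (1 - (5 + d) / R) ^ 2)) * (y - x)))) := by
      rw [hCdef]; ring
    linarith
  have hl : l = 5 ^ M * W y := by
    rw [key y hy hyd] at h
    rcases mul_eq_zero.1 h with h | h
    · exact absurd h (by positivity)
    · linarith
  rw [key x hx (hxy.trans hyd)]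
  have h5 : 5 ^ M * C * (y - x) ≤ l - 5 ^ M * W x := by
    have := mul_le_mul_of_nonneg_left hWC (by positivity : (0 : ℝ) ≤ 5 ^ M)
    nth_rewrite 1 [hl]
    linarith
  have h6 : 0 ≤ 5 ^ M * C * (y - x) := mul_nonneg (by positivity) (by linarith)
  exact h5.trans (le_mul_of_one_le_left (h6.trans h5) (one_le_pow₀ (by linarith)))

end

open ComplexOrder in
theorem ArithmeticFunction.IsMultiplicative.exists_real_of_prime_pow {f : ArithmeticFunction ℂ}
    (hf : f.IsMultiplicative)
    (h : ∀ p k : ℕ, p.Prime → ∃ z : ℤ, f (p ^ k) = z ∧ 0 ≤ z ∧ (Even k → 1 ≤ z)) :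
    ∃ b : ℕ → ℝ, (∀ n, (b n : ℂ) = f n) ∧ (∀ n, 0 ≤ b n) ∧ ∀ j, j ≠ 0 → 1 ≤ b (j ^ 2) := by
  have h0 : ∀ n, 0 ≤ f n := fun n ↦ by
    rcases eq_or_ne n 0 with rfl | hn
    · simp
    rw [hf.multiplicative_factorization _ hn]
    refine Finset.prod_nonneg fun p hp ↦ ?_
    obtain ⟨z, hz, hz0, -⟩ := h p (n.factorization p) (Nat.prime_of_mem_primeFactors hp)
    simp only [hz]
    exact_mod_cast hz0
  have hre : ∀ n, ((f n).re : ℂ) = f n := fun n ↦ by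
    have := (Complex.le_def.1 (h0 n)).2
    apply Complex.ext <;> simp_all
  refine ⟨fun n ↦ (f n).re, hre, fun n ↦ (Complex.le_def.1 (h0 n)).1, fun j hj ↦ ?_⟩
  suffices 1 ≤ f (j ^ 2) from (Complex.le_def.1 this).1
  rw [hf.multiplicative_factorization _ (pow_ne_zero 2 hj)]
  refine Finset.prod_induction _ (fun z : ℂ ↦ 1 ≤ z) (fun x y ↦ one_le_mul_of_one_le_of_one_le)
    le_rfl fun p hp ↦ ?_
  obtain ⟨z, hz, -, hz1⟩ := h p ((j ^ 2).factorization p) (Nat.prime_of_mem_primeFactors hp)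
  simp only [hz]
  exact_mod_cast hz1 (by simp [Nat.factorization_pow])

theorem Int.even_one_le_sum_range_pow {a : ℤ} (ha : a = 0 ∨ a = 1 ∨ a = -1) (k : ℕ) :
    0 ≤ ∑ i ∈ Finset.range (k + 1), a ^ i ∧ (Even k → 1 ≤ ∑ i ∈ Finset.range (k + 1), a ^ i) := by
  rcases ha with rfl | rfl | rfl
  · simp [Finset.sum_range_succ']
  · simp only [one_pow, Finset.sum_const, Finset.card_range, nsmul_eq_mul, mul_one]
    exact ⟨by positivity, fun _ ↦ by push_cast; omega⟩
  · rw [neg_one_geom_sum]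
    split_ifs with h <;> simp_all [Nat.even_add_one]

theorem Int.four_mul_sum_range_alternating (k n : ℕ) :
    4 * ∑ i ∈ Finset.range n, ((i : ℤ) + 1) * (k - i + 1) * (-1) ^ i =
      (-1) ^ n * (2 * n ^ 2 - 2 * (k + 1) * n - (k + 2)) + (k + 2) := by
  induction n with
  | zero => simp
  | succ n ih => rw [Finset.sum_range_succ, mul_add, ih, pow_succ]; push_cast; ring

theorem Int.even_one_le_sum_range_mul {a c : ℤ} (ha : a = 0 ∨ a = 1 ∨ a = -1)
    (hc : c = 0 ∨ c = 1 ∨ c = -1) (k : ℕ) :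
    0 ≤ ∑ i ∈ Finset.range (k + 1), (∑ j ∈ Finset.range (i + 1), a ^ j) *
        (c ^ (k - i) * ∑ j ∈ Finset.range (k - i + 1), a ^ j) ∧
      (Even k → 1 ≤ ∑ i ∈ Finset.range (k + 1), (∑ j ∈ Finset.range (i + 1), a ^ j) *
        (c ^ (k - i) * ∑ j ∈ Finset.range (k - i + 1), a ^ j)) := by
  have key : (∀ i ∈ Finset.range (k + 1), 0 ≤ (∑ j ∈ Finset.range (i + 1), a ^ j) *
      (c ^ (k - i) * ∑ j ∈ Finset.range (k - i + 1), a ^ j)) →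
    0 ≤ ∑ i ∈ Finset.range (k + 1), (∑ j ∈ Finset.range (i + 1), a ^ j) *
        (c ^ (k - i) * ∑ j ∈ Finset.range (k - i + 1), a ^ j) ∧
      (Even k → 1 ≤ ∑ i ∈ Finset.range (k + 1), (∑ j ∈ Finset.range (i + 1), a ^ j) *
        (c ^ (k - i) * ∑ j ∈ Finset.range (k - i + 1), a ^ j)) := fun h ↦ by
    refine ⟨Finset.sum_nonneg h, fun hk ↦ ?_⟩
    refine le_trans ?_ (Finset.single_le_sum h (Finset.self_mem_range_succ k))
    simpa using (Int.even_one_le_sum_range_pow ha k).2 hk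
  by_cases hc0 : 0 ≤ c
  · exact key fun i _ ↦ mul_nonneg (Int.even_one_le_sum_range_pow ha i).1
      (mul_nonneg (pow_nonneg hc0 _) (Int.even_one_le_sum_range_pow ha _).1)
  obtain rfl : c = -1 := by omega
  rcases ha with rfl | rfl | rfl
  · have : ∀ i, ∑ j ∈ Finset.range (i + 1), (0 : ℤ) ^ j = 1 := fun i ↦ by
      simp [Finset.sum_range_succ']
    simp only [this, one_mul, mul_one]
    have h2 := Finset.sum_range_reflect (fun j ↦ (-1 : ℤ) ^ j) (k + 1)
    simp only [add_tsub_cancel_right] at h2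
    rw [h2]
    exact Int.even_one_le_sum_range_pow (by simp) k
  · have h3 : ∑ i ∈ Finset.range (k + 1), (∑ j ∈ Finset.range (i + 1), (1 : ℤ) ^ j) *
        ((-1) ^ (k - i) * ∑ j ∈ Finset.range (k - i + 1), (1 : ℤ) ^ j) =
        (-1) ^ k * ∑ i ∈ Finset.range (k + 1), ((i : ℤ) + 1) * (k - i + 1) * (-1) ^ i := by
      rw [Finset.mul_sum]
      refine Finset.sum_congr rfl fun i hi ↦ ?_
      have hik : i ≤ k := Finset.mem_range_succ_iff.1 hi
      obtain ⟨m, rfl⟩ := Nat.exists_eq_add_of_le hik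
      have : (-1 : ℤ) ^ i * (-1) ^ i = 1 := by rw [← mul_pow]; simp
      simp only [one_pow, Finset.sum_const, Finset.card_range, nsmul_eq_mul, mul_one,
        add_tsub_cancel_left, pow_add]
      push_cast
      linear_combination (-(i + 1) * (m + 1) * (-1) ^ m : ℤ) * this
    rw [h3]
    have h4 := Int.four_mul_sum_range_alternating k (k + 1)
    set T := ∑ i ∈ Finset.range (k + 1), ((i : ℤ) + 1) * (k - i + 1) * (-1) ^ i
    rcases Nat.even_or_odd k with hk | hk
    · rw [hk.neg_one_pow, one_mul]
      rw [hk.add_one.neg_one_pow] at h4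
      push_cast at h4
      have : 4 * T = 2 * (k + 2) := by linear_combination h4
      constructor <;> intros <;> omega
    · rw [hk.add_one.neg_one_pow] at h4
      push_cast at h4
      have : 4 * T = 0 := by linear_combination h4
      have hT : T = 0 := by omega
      simp [hT, Nat.not_even_iff_odd.2 hk]
  · refine key fun i hi ↦ ?_
    have : ∀ m, ∑ j ∈ Finset.range (m + 1), (-1 : ℤ) ^ j = if Even m then 1 else 0 := fun m ↦ by
      rw [neg_one_geom_sum]
      split_ifs with h1 h2 h2 <;> simp_all [Nat.even_add_one]
    rw [this, this]
    split_ifs with h1 h2 <;> simp_all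

theorem DirichletCharacter.exists_int_eq_of_sq_eq_one {N : ℕ} {χ : DirichletCharacter ℂ N}
    (hχ : χ ^ 2 = 1) (x : ZMod N) : ∃ a : ℤ, (a = 0 ∨ a = 1 ∨ a = -1) ∧ χ x = a := by
  rcases MulChar.isQuadratic_iff_sq_eq_one.mpr hχ x with h | h | h
  exacts [⟨0, by simp, by simp [h]⟩, ⟨1, by simp, by simp [h]⟩, ⟨-1, by simp, by simp [h]⟩]

open DirichletCharacter in
theorem DirichletCharacter.zetaMul_prime_pow {N : ℕ} (χ : DirichletCharacter ℂ N) {p : ℕ}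
    (hp : p.Prime) (k : ℕ) : zetaMul χ (p ^ k) = ∑ j ∈ Finset.range (k + 1), χ p ^ j := by
  rw [zetaMul, ArithmeticFunction.coe_zeta_mul_apply, Nat.sum_divisors_prime_pow hp]
  refine Finset.sum_congr rfl fun i _ ↦ ?_
  rw [← χ.apply_eq_toArithmeticFunction_apply (pow_ne_zero _ hp.ne_zero), Nat.cast_pow, map_pow]

theorem Nat.Prime.sum_divisorsAntidiagonal_pow {M : Type*} [AddCommMonoid M] {p : ℕ}
    (hp : p.Prime) (k : ℕ) (f : ℕ × ℕ → M) :
    ∑ x ∈ (p ^ k).divisorsAntidiagonal, f x =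
      ∑ i ∈ Finset.range (k + 1), f (p ^ i, p ^ (k - i)) := by
  rw [Nat.sum_divisorsAntidiagonal (n := p ^ k) (fun x y ↦ f (x, y)), Nat.sum_divisors_prime_pow hp]
  refine Finset.sum_congr rfl fun i hi ↦ ?_
  rw [Nat.pow_div (Finset.mem_range_succ_iff.1 hi) hp.pos]

theorem DirichletCharacter.LSeriesSummable_toArithmeticFunction {N : ℕ}
    (χ : DirichletCharacter ℂ N) {s : ℂ} (hs : 1 < s.re) :
    LSeriesSummable (toArithmeticFunction (χ ·)) s := by
  refine LSeriesSummable_of_bounded_of_one_lt_re (m := 1) (fun n hn ↦ ?_) hs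
  rw [← χ.apply_eq_toArithmeticFunction_apply hn]
  exact norm_le_one χ _

theorem DirichletCharacter.LSeries_toArithmeticFunction {N : ℕ} [NeZero N]
    (χ : DirichletCharacter ℂ N) {s : ℂ} (hs : 1 < s.re) :
    LSeries (toArithmeticFunction (χ ·)) s = χ.LFunction s := by
  rw [χ.LFunction_eq_LSeries hs]
  exact (LSeries_congr χ.apply_eq_toArithmeticFunction_apply s).symm

theorem DirichletCharacter.LSeries_zetaMul {N : ℕ} [NeZero N]
    (χ : DirichletCharacter ℂ N) {s : ℂ} (hs : 1 < s.re) :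
    LSeries χ.zetaMul s = riemannZeta s * χ.LFunction s := by
  have hz : ⇑((ArithmeticFunction.zeta : ArithmeticFunction ℕ) : ArithmeticFunction ℂ) =
      fun n ↦ ((ArithmeticFunction.zeta n : ℕ) : ℂ) :=
    funext fun n ↦ ArithmeticFunction.natCoe_apply
  have hs' := ArithmeticFunction.LSeriesSummable_zeta_iff.mpr hs
  rw [← hz] at hs'
  rw [zetaMul, ArithmeticFunction.LSeries_mul' hs' (χ.LSeriesSummable_toArithmeticFunction hs),
    χ.LSeries_toArithmeticFunction hs, ← ArithmeticFunction.LSeries_zeta_eq_riemannZeta hs, hz]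

theorem riemannZeta₁_eq_sub_one_mul {s : ℂ} (hs : 1 < s.re) :
    riemannZeta₁ s = (s - 1) * riemannZeta s := by
  have : s - 1 ≠ 0 := sub_ne_zero.2 (by rintro rfl; simp at hs)
  rw [riemannZeta_eq_inv_sub_mul (sub_ne_zero.1 this), mul_inv_cancel_left₀ this]

theorem LSeries.abscissaOfAbsConv_le_one {f : ℕ → ℂ} (h : ∀ s : ℂ, 1 < s.re → LSeriesSummable f s) :
    abscissaOfAbsConv f ≤ 1 :=
  abscissaOfAbsConv_le_of_forall_lt_LSeriesSummable fun y hy ↦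
    h y (by simpa using (by exact_mod_cast hy : (1 : ℝ) < y))

open LSeries in
theorem DirichletCharacter.exists_coeff_zeta_mul_LFunction {N : ℕ} [NeZero N]
    {χ : DirichletCharacter ℂ N} (h2 : χ ^ 2 = 1) :
    ∃ b : ℕ → ℝ, (∀ n, 0 ≤ b n) ∧ (∀ j, j ≠ 0 → 1 ≤ b (j ^ 2)) ∧
      abscissaOfAbsConv (fun n ↦ (b n : ℂ)) ≤ 1 ∧ ∀ s : ℂ, 1 < s.re →
        riemannZeta₁ s * χ.LFunction s = (s - 1) * LSeries (fun n ↦ (b n : ℂ)) s := by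
  obtain ⟨b, hb, hb0, hb2⟩ := χ.isMultiplicative_zetaMul.exists_real_of_prime_pow fun p k hp ↦ by
    obtain ⟨a, ha, hχa⟩ := exists_int_eq_of_sq_eq_one h2 (p : ZMod N)
    obtain ⟨h0, h1⟩ := Int.even_one_le_sum_range_pow ha k
    exact ⟨_, by rw [χ.zetaMul_prime_pow hp, hχa]; push_cast; rfl, h0, h1⟩
  have hbf : (fun n ↦ (b n : ℂ)) = χ.zetaMul := funext hb
  refine ⟨b, hb0, hb2, ?_, fun s hs ↦ ?_⟩
  · rw [hbf]
    exact abscissaOfAbsConv_le_one fun s hs ↦ χ.LSeriesSummable_zetaMul hs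
  · rw [hbf, χ.LSeries_zetaMul hs, riemannZeta₁_eq_sub_one_mul hs, mul_assoc]

open LSeries in
theorem DirichletCharacter.exists_coeff_zeta_mul_LFunction_mul {N₁ N₂ N₃ : ℕ} [NeZero N₁]
    [NeZero N₂] [NeZero N₃] {χ₁ : DirichletCharacter ℂ N₁} {χ₂ : DirichletCharacter ℂ N₂}
    {χ₃ : DirichletCharacter ℂ N₃} (h₁ : χ₁ ^ 2 = 1) (h₂ : χ₂ ^ 2 = 1)
    (h₃ : ∀ n : ℕ, χ₃ n = χ₁ n * χ₂ n) :
    ∃ b : ℕ → ℝ, (∀ n, 0 ≤ b n) ∧ (∀ j, j ≠ 0 → 1 ≤ b (j ^ 2)) ∧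
      abscissaOfAbsConv (fun n ↦ (b n : ℂ)) ≤ 1 ∧ ∀ s : ℂ, 1 < s.re →
        riemannZeta₁ s * χ₁.LFunction s * (χ₂.LFunction s * χ₃.LFunction s) =
          (s - 1) * LSeries (fun n ↦ (b n : ℂ)) s := by
  set f : ArithmeticFunction ℂ := toArithmeticFunction (χ₂ ·) * toArithmeticFunction (χ₃ ·) with hf
  have hfm : f.IsMultiplicative :=
    χ₂.isMultiplicative_toArithmeticFunction.mul χ₃.isMultiplicative_toArithmeticFunction
  have hfs : ∀ s : ℂ, 1 < s.re → LSeriesSummable f s := fun s hs ↦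
    ArithmeticFunction.LSeriesSummable_mul (χ₂.LSeriesSummable_toArithmeticFunction hs)
      (χ₃.LSeriesSummable_toArithmeticFunction hs)
  have hfL : ∀ s : ℂ, 1 < s.re → LSeries f s = χ₂.LFunction s * χ₃.LFunction s := fun s hs ↦ by
    rw [hf, ArithmeticFunction.LSeries_mul' (χ₂.LSeriesSummable_toArithmeticFunction hs)
      (χ₃.LSeriesSummable_toArithmeticFunction hs), χ₂.LSeries_toArithmeticFunction hs,
      χ₃.LSeries_toArithmeticFunction hs]
  have hfp : ∀ p k : ℕ, p.Prime →
      f (p ^ k) = χ₂ p ^ k * ∑ j ∈ Finset.range (k + 1), χ₁ p ^ j := fun p k hp ↦ by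
    rw [hf, ArithmeticFunction.mul_apply, hp.sum_divisorsAntidiagonal_pow,
      ← Finset.sum_range_reflect (fun j ↦ χ₁ p ^ j), Finset.mul_sum]
    refine Finset.sum_congr rfl fun i hi ↦ ?_
    have hik : i ≤ k := Finset.mem_range_succ_iff.1 hi
    rw [← χ₂.apply_eq_toArithmeticFunction_apply (pow_ne_zero _ hp.ne_zero),
      ← χ₃.apply_eq_toArithmeticFunction_apply (pow_ne_zero _ hp.ne_zero), h₃]
    obtain ⟨m, rfl⟩ := Nat.exists_eq_add_of_le hik
    simp only [Nat.cast_pow, map_pow, add_tsub_cancel_left, add_tsub_cancel_right]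
    ring
  obtain ⟨b, hb, hb0, hb2⟩ :=
      (χ₁.isMultiplicative_zetaMul.mul hfm).exists_real_of_prime_pow fun p k hp ↦ by
    obtain ⟨a, ha, hχa⟩ := exists_int_eq_of_sq_eq_one h₁ (p : ZMod N₁)
    obtain ⟨c, hc, hχc⟩ := exists_int_eq_of_sq_eq_one h₂ (p : ZMod N₂)
    obtain ⟨h0, h1⟩ := Int.even_one_le_sum_range_mul ha hc k
    refine ⟨_, ?_, h0, h1⟩
    rw [ArithmeticFunction.mul_apply, hp.sum_divisorsAntidiagonal_pow]
    push_cast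
    refine Finset.sum_congr rfl fun i _ ↦ ?_
    rw [χ₁.zetaMul_prime_pow hp, hfp p _ hp, hχa, hχc]
  have hbf : (fun n ↦ (b n : ℂ)) = (χ₁.zetaMul * f : ArithmeticFunction ℂ) := funext hb
  refine ⟨b, hb0, hb2, ?_, fun s hs ↦ ?_⟩
  · rw [hbf]
    exact abscissaOfAbsConv_le_one fun s hs ↦
      ArithmeticFunction.LSeriesSummable_mul (χ₁.LSeriesSummable_zetaMul hs) (hfs s hs)
  · rw [hbf, ArithmeticFunction.LSeries_mul' (χ₁.LSeriesSummable_zetaMul hs) (hfs s hs),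
      χ₁.LSeries_zetaMul hs, hfL s hs, riemannZeta₁_eq_sub_one_mul hs]
    ring

theorem Complex.bounds_of_norm_sub_six_eq {s : ℂ} (h : ‖s - 6‖ = 5.95) :
    0.05 ≤ s.re ∧ 0.95 ≤ ‖s - 1‖ ∧ ‖s‖ / s.re ≤ 7.77 := by
  have h1 : (6 - s.re) ≤ 5.95 := by
    rw [← h, ← norm_neg]
    simpa using Complex.re_le_norm (-(s - 6))
  have hre : 0.05 ≤ s.re := by linarith
  refine ⟨hre, ?_, ?_⟩
  · have : ‖s - 6‖ ≤ ‖s - 1‖ + ‖(5 : ℂ)‖ := by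
      rw [show s - 6 = (s - 1) - 5 by ring]
      exact norm_sub_le _ _
    rw [h] at this
    norm_num at this ⊢
    linarith
  · have h2 : (s.re - 6) ^ 2 + s.im ^ 2 = 5.95 ^ 2 := by
      rw [← h, ← Complex.normSq_eq_norm_sq, Complex.normSq_apply]
      simp
      ring
    rw [div_le_iff₀ (by linarith)]
    refine abs_le_of_sq_le_sq' ?_ (by linarith) |>.2
    rw [← Complex.normSq_eq_norm_sq, Complex.normSq_apply]
    nlinarith [sq_nonneg (7.77 * s.re - 6 / 7.77)]

theorem norm_riemannZeta₁_mul_sub_le {G : ℂ → ℂ} {G₀ G₁ : ℝ} {s : ℂ} (h : ‖s - 6‖ = 5.95)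
    (h0 : ‖G s‖ ≤ G₀) (h1 : ‖G 1‖ ≤ G₁) :
    ‖riemannZeta₁ s * G s - G 1‖ ≤ (4.385 * G₀ + (G₀ + G₁) / 0.95) * ‖s - 1‖ := by
  obtain ⟨hre, hs1, hQ⟩ := Complex.bounds_of_norm_sub_six_eq h
  have hz : ‖riemannZeta₁ s - 1‖ ≤ 4.385 * ‖s - 1‖ := by
    have := norm_riemannZeta₁_sub_le (s := s) (by linarith)
    calc ‖riemannZeta₁ s - 1‖ = ‖(riemannZeta₁ s - 1 - (s - 1) / 2) + (s - 1) / 2‖ := by ring_nf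
      _ ≤ ‖s - 1‖ * (‖s‖ / s.re / 2) + ‖(s - 1) / 2‖ := (norm_add_le _ _).trans (by gcongr)
      _ = ‖s - 1‖ * (‖s‖ / s.re / 2 + 1 / 2) := by simp; ring
      _ ≤ ‖s - 1‖ * (7.77 / 2 + 1 / 2) := by gcongr
      _ = 4.385 * ‖s - 1‖ := by ring
  have hG : ‖G s - G 1‖ ≤ (G₀ + G₁) / 0.95 * ‖s - 1‖ := by
    have h3 : ‖G s - G 1‖ ≤ G₀ + G₁ := (norm_sub_le _ _).trans (by gcongr)
    have h4 : 0 ≤ G₀ + G₁ := (norm_nonneg _).trans h3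
    calc ‖G s - G 1‖ ≤ (G₀ + G₁) / 0.95 * 0.95 := by rwa [div_mul_cancel₀ _ (by norm_num)]
      _ ≤ _ := by gcongr
  calc ‖riemannZeta₁ s * G s - G 1‖ = ‖(riemannZeta₁ s - 1) * G s + (G s - G 1)‖ := by ring_nf
    _ ≤ ‖riemannZeta₁ s - 1‖ * ‖G s‖ + ‖G s - G 1‖ := (norm_add_le _ _).trans (by rw [norm_mul])
    _ ≤ 4.385 * ‖s - 1‖ * G₀ + (G₀ + G₁) / 0.95 * ‖s - 1‖ := by gcongr
    _ = _ := by ring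

theorem Real.div_le_exp_neg_of_le {t x : ℝ} (n : ℕ) (hn : t ≤ n) (h : x ≤ (1 - t / n) ^ n) :
    x ≤ Real.exp (-t) :=
  h.trans (Real.one_sub_div_pow_le_exp_neg hn)

theorem truncation_error_le {k : ℝ} (hk : 11.2 ≤ k) {δ : ℝ} (hδ : 0 < δ) (hδk : δ * k ≤ 1 / 2)
    {M : ℕ} (hM : 9.5 * k ≤ M) :
    43.31 * (2 * Real.exp (k / 2) * (1 + k)) * ((5 + δ) / 5.95) ^ M / (1 - (5 + δ) / 5.95) ≤
      0.065 := by
  have hδ1 : δ ≤ 5 / 112 := by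
    by_contra! h
    nlinarith
  have h1 : (5 + δ) / 5.95 ≤ Real.exp (-0.164) := by
    refine Real.div_le_exp_neg_of_le 32 (by norm_num) ?_
    calc (5 + δ) / 5.95 ≤ (5 + 5 / 112) / 5.95 := by gcongr
      _ ≤ _ := by norm_num
  have h2 : ((5 + δ) / 5.95) ^ M ≤ Real.exp (-(1.558 * k)) := by
    calc ((5 + δ) / 5.95) ^ M ≤ Real.exp (-0.164) ^ M := by gcongr
      _ = Real.exp (-0.164 * M) := by rw [← Real.exp_nat_mul]; ring_nf
      _ ≤ _ := Real.exp_le_exp.2 (by linarith)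
  have h3 : 1 + k ≤ 12.2 * Real.exp ((k - 56 / 5) / (61 / 5)) := by
    have := Real.add_one_le_exp ((k - 56 / 5) / (61 / 5))
    linarith
  have h4 : (125000 : ℝ) ≤ Real.exp 11.75 := by
    have : (1 + 0.25 + 0.25 ^ 2 / 2 + 0.25 ^ 3 / 6 : ℝ) ≤ Real.exp 0.25 := by
      have := Real.sum_le_exp_of_nonneg (x := 0.25) (by norm_num) 4
      norm_num [Finset.sum_range_succ, Nat.factorial] at this ⊢
      linarith
    calc (125000 : ℝ) ≤ (1 + 0.25 + 0.25 ^ 2 / 2 + 0.25 ^ 3 / 6) ^ 47 := by norm_num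
      _ ≤ Real.exp 0.25 ^ 47 := by gcongr
      _ = Real.exp 11.75 := by rw [← Real.exp_nat_mul]; norm_num
  rw [div_le_iff₀ (by rw [sub_pos, div_lt_one] <;> linarith)]
  calc 43.31 * (2 * Real.exp (k / 2) * (1 + k)) * ((5 + δ) / 5.95) ^ M
      ≤ 43.31 * (2 * Real.exp (k / 2) * (12.2 * Real.exp ((k - 56 / 5) / (61 / 5)))) *
        Real.exp (-(1.558 * k)) := by gcongr
    _ = 43.31 * 2 * 12.2 * Real.exp (k / 2 + (k - 56 / 5) / (61 / 5) + -(1.558 * k)) := by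
        rw [Real.exp_add, Real.exp_add]; ring
    _ ≤ 43.31 * 2 * 12.2 * Real.exp (-11.75) := by
        gcongr
        linarith
    _ ≤ 43.31 * 2 * 12.2 * (125000)⁻¹ := by
        rw [Real.exp_neg]; gcongr
    _ ≤ 0.065 * (1 - (5 + 5 / 112) / 5.95) := by norm_num
    _ ≤ _ := by gcongr

theorem mul_exp_mul_pow_lt {k : ℝ} (hk : 11.2 ≤ k) {v : ℝ} (hv : 1 / 4 ≤ v)
    {M : ℕ} (hM : M ≤ 9.5 * k + 1) :
    2.62 * Real.exp (-(4 * v)) * ((5 + v / k) / 5) ^ M < 1.56 := by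
  have hk0 : 0 < k := by linarith
  have h1 : (5 + v / k) / 5 ≤ Real.exp (v / (5 * k)) := by
    have := Real.add_one_le_exp (v / (5 * k))
    convert this using 1
    field_simp
    ring
  have h2 : ((5 + v / k) / 5) ^ M ≤ Real.exp (1.9 * v + v / 56) := by
    calc ((5 + v / k) / 5) ^ M ≤ Real.exp (v / (5 * k)) ^ M := by gcongr
      _ = Real.exp (v / (5 * k) * M) := by rw [← Real.exp_nat_mul]; ring_nf
      _ ≤ _ := by
        gcongr
        calc v / (5 * k) * M ≤ v / (5 * k) * (9.5 * k + 1) := by gcongr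
          _ = 1.9 * v + v / (5 * k) := by field_simp; ring
          _ ≤ _ := by gcongr; linarith
  calc 2.62 * Real.exp (-(4 * v)) * ((5 + v / k) / 5) ^ M
      ≤ 2.62 * Real.exp (-(4 * v)) * Real.exp (1.9 * v + v / 56) := by gcongr
    _ = 2.62 * Real.exp (-(4 * v) + (1.9 * v + v / 56)) := by rw [Real.exp_add _ (_ + _)]; ring
    _ ≤ 2.62 * Real.exp (-0.52) := by gcongr; linarith
    _ ≤ 2.62 * (1.681)⁻¹ := by
        rw [Real.exp_neg]
        gcongr
        have := Real.sum_le_exp_of_nonneg (x := 0.52) (by norm_num) 5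
        norm_num [Finset.sum_range_succ, Nat.factorial] at this ⊢
        linarith
    _ < 1.56 := by norm_num

theorem DirichletCharacter.LFunction_ofReal_re_nonneg {N : ℕ} [NeZero N]
    {χ : DirichletCharacter ℂ N} (hχ : χ ≠ 1) (h2 : χ ^ 2 = 1) {σ : ℝ} (h0 : 0 < σ)
    (h : ∀ x : ℝ, σ < x → x < 1 → χ.LFunction x ≠ 0) : 0 ≤ (χ.LFunction σ).re := by
  by_cases hσ : χ.LFunction σ = 0
  · simp [hσ]
  · refine (LFunction_ofReal_re_pos_of_ne_zero hχ h2 h0 fun x hx hx1 ↦ ?_).le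
    rcases hx.eq_or_lt with rfl | hx
    exacts [hσ, h x hx hx1]

theorem DirichletCharacter.ofReal_re_LFunction_ofReal {N : ℕ} [NeZero N]
    {χ : DirichletCharacter ℂ N} (hχ : χ ≠ 1) (h2 : χ ^ 2 = 1) {σ : ℝ} (h0 : 0 < σ) :
    ((χ.LFunction σ).re : ℂ) = χ.LFunction σ :=
  Complex.conj_eq_iff_re.1 (conj_LFunction_ofReal hχ h2 h0)

theorem DirichletCharacter.mul_le_LFunction_one_mul_pow {N : ℕ} [NeZero N]
    {χ : DirichletCharacter ℂ N} (hχ : χ ≠ 1) (h2 : χ ^ 2 = 1) {δ : ℝ} (hδ : 0 < δ)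
    (hδ' : δ ≤ 1 / 2) (h : ∀ x : ℝ, 1 - δ < x → x < 1 → χ.LFunction x ≠ 0)
    {M : ℕ} (hM : 100 ≤ M) :
    δ * (1.625 - 43.31 * (2 * √N * (1 + Real.log N)) * ((5 + δ) / 5.95) ^ M /
        (1 - (5 + δ) / 5.95)) ≤ (χ.LFunction 1).re * ((5 + δ) / 5) ^ M := by
  obtain ⟨b, hb, hb2, hab, hHb⟩ := exists_coeff_zeta_mul_LFunction h2
  set P : ℝ := 2 * √N * (1 + Real.log N) with hPdef
  have hP := norm_sum_range_le hχ
  rw [← hPdef] at hP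
  have hP0 : 0 ≤ P := (norm_nonneg _).trans (hP 0)
  set l : ℝ := (χ.LFunction 1).re with hl
  have hl1 : (l : ℂ) = χ.LFunction 1 := by
    simpa using ofReal_re_LFunction_ofReal hχ h2 one_pos
  have hH1 : riemannZeta₁ 1 * χ.LFunction 1 = l := by rw [riemannZeta₁_one, one_mul, hl1]
  have hB : ∀ s : ℂ, ‖s - 6‖ = 5.95 → ‖riemannZeta₁ s * χ.LFunction s - l‖ ≤
      43.31 * P * ‖s - 1‖ := fun s hs ↦ by
    obtain ⟨hre, -, hQ⟩ := Complex.bounds_of_norm_sub_six_eq hs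
    have hG0 : ‖χ.LFunction s‖ ≤ P * 7.77 :=
      (norm_LFunction_le_of_pos_re hχ hP (by linarith)).trans (by gcongr)
    have hG1 : ‖χ.LFunction 1‖ ≤ P := by
      simpa using norm_LFunction_le_of_pos_re hχ hP (s := 1) (by simp)
    rw [hl1]
    refine (norm_riemannZeta₁_mul_sub_le (G := χ.LFunction) hs hG0 hG1).trans ?_
    rw [show 4.385 * (P * 7.77) + (P * 7.77 + P) / 0.95 = (4.385 * 7.77 + 8.77 / 0.95) * P by ring]
    gcongr
    norm_num
  obtain ⟨g, hg, hA, hδH⟩ := exists_taylor_coeff_LSeries hb hab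
    (differentiable_riemannZeta₁.mul (differentiable_LFunction hχ)) hHb hH1
    (R := 5.95) (by norm_num) hB
  have hnn : 0 ≤ l - δ * ∑' m, g m * (5 + δ) ^ m := by
    have h3 := hδH δ hδ (by norm_num; linarith)
    obtain ⟨r, hr, hr1⟩ := exists_riemannZeta₁_ofReal_eq (σ := 1 - δ) (by linarith) (by linarith)
    simp only [Pi.mul_apply] at h3
    rw [hr1, ← ofReal_re_LFunction_ofReal hχ h2 (by linarith), ← Complex.ofReal_mul,
      Complex.ofReal_inj] at h3
    rw [← h3]
    exact mul_nonneg hr.le (LFunction_ofReal_re_nonneg hχ h2 (by linarith) h)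
  have h5 := mul_le_mul_pow_of_nonneg hg M hδ (by linarith) hnn
  refine le_trans ?_ h5
  gcongr
  exact sum_range_taylor_ge hb2 hA (by linarith) (by linarith) hM

theorem DirichletCharacter.lt_LFunction_one_of_ne_zero {N : ℕ} [NeZero N]
    {χ : DirichletCharacter ℂ N} (hχ : χ ≠ 1) (h2 : χ ^ 2 = 1) {ε : ℝ} (hε0 : 0 < ε)
    (hN : 11.2 ≤ Real.log N) (hεN : 1 ≤ ε * Real.log N)
    (h : ∀ x : ℝ, 1 - ε / 4 < x → 0.95 < x → x < 1 → χ.LFunction x ≠ 0) :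
    0.655 * ε / (N : ℝ) ^ ε < (χ.LFunction 1).re := by
  set k := Real.log N with hk
  have hk0 : 0 < k := by linarith
  have hN0 : (0 : ℝ) < N := by exact_mod_cast NeZero.pos N
  set v := min (ε * k / 4) (1 / 2) with hv
  have hv4 : 1 / 4 ≤ v := le_min (by linarith) (by norm_num)
  have hv2 : v ≤ 1 / 2 := min_le_right _ _
  have hv0 : 0 < v := by linarith
  have hδ : 0 < v / k := by positivity
  have hδε : v / k ≤ ε / 4 := by
    rw [div_le_iff₀ hk0]
    exact (min_le_left _ _).trans (by linarith)
  have hδ2 : v / k < 0.05 := by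
    rw [div_lt_iff₀ hk0]
    linarith
  set M := ⌈9.5 * k⌉₊ with hM
  have hM1 : 9.5 * k ≤ M := Nat.le_ceil _
  have hM2 : (M : ℝ) ≤ 9.5 * k + 1 := (Nat.ceil_lt_add_one (by positivity)).le
  have hM100 : 100 ≤ M := by
    have : (100 : ℝ) ≤ M := by linarith
    exact_mod_cast this
  have h1 := mul_le_LFunction_one_mul_pow hχ h2 hδ (by linarith)
    (fun x hx hx1 ↦ h x (by linarith) (by linarith) hx1) hM100
  have h3 := truncation_error_le hN hδ (by rw [div_mul_cancel₀ _ hk0.ne']; exact hv2) hM1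
  have h4 := mul_exp_mul_pow_lt hN hv4 hM2
  have hsqrt : √(N : ℝ) = Real.exp (k / 2) := by
    rw [Real.sqrt_eq_rpow, Real.rpow_def_of_pos hN0, ← hk]
    ring_nf
  rw [hsqrt, ← hk] at h1
  have h5 : ε * k * Real.exp (-(ε * k)) ≤ 4 * v * Real.exp (-(4 * v)) := by
    rcases le_total (ε * k / 4) (1 / 2) with h6 | h6
    · rw [hv, min_eq_left h6]
      ring_nf
      rfl
    · rw [hv, min_eq_right h6]
      have h7 := Real.add_one_le_exp (ε * k - 2)
      have h8 : Real.exp (-(4 * (1 / 2))) = Real.exp (ε * k - 2) * Real.exp (-(ε * k)) := by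
        rw [← Real.exp_add]; ring_nf
      rw [h8, ← mul_assoc]
      exact mul_le_mul_of_nonneg_right (by linarith) (Real.exp_pos _).le
  have h6 : 0.655 * ε / (N : ℝ) ^ ε ≤ v / k * (2.62 * Real.exp (-(4 * v))) := by
    rw [Real.rpow_def_of_pos hN0, ← hk, div_eq_mul_inv, ← Real.exp_neg, mul_comm k ε]
    have : 0.655 * ε * Real.exp (-(ε * k)) = 0.655 / k * (ε * k * Real.exp (-(ε * k))) := by
      field_simp
    rw [this]
    calc _ ≤ 0.655 / k * (4 * v * Real.exp (-(4 * v))) := by gcongr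
      _ = _ := by ring
  refine h6.trans_lt (lt_of_mul_lt_mul_right (a := ((5 + v / k) / 5) ^ M) ?_ (by positivity))
  refine lt_of_lt_of_le ?_ h1
  rw [mul_assoc]
  gcongr
  linarith

theorem one_add_log_two_mul_exp_mul_le {k : ℝ} (hk : 22.4 ≤ k) :
    1 + Real.log (2 * Real.exp (k / 2) * (1 + k)) ≤ 0.72 * k := by
  have h1 : 2 * Real.exp (k / 2) * (1 + k) =
      Real.exp (k / 2 + 4) * (2 * (1 + k) / Real.exp 4) := by
    rw [Real.exp_add]; field_simp
  have h2 : (54 : ℝ) ≤ Real.exp 4 := by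
    have := Real.exp_one_gt_d9
    calc (54 : ℝ) ≤ 2.718 ^ 4 := by norm_num
      _ ≤ Real.exp 1 ^ 4 := by gcongr; linarith
      _ = Real.exp 4 := by rw [← Real.exp_nat_mul]; norm_num
  have h3 : 0 < 2 * (1 + k) / Real.exp 4 := by
    have : 0 < 1 + k := by linarith
    positivity
  rw [h1, Real.log_mul (Real.exp_ne_zero _) h3.ne', Real.log_exp]
  have h4 := Real.log_le_sub_one_of_pos h3
  have h5 : 2 * (1 + k) / Real.exp 4 ≤ 2 * (1 + k) / 54 := by gcongr
  linarith

theorem truncation_error_le_of_triple {k : ℝ} (hk : 22.4 ≤ k) {δ : ℝ} (hδ0 : 0 ≤ δ) (hδ : δ ≤ 0.05)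
    {M : ℕ} (hM : 12.5 * k ≤ M) :
    2600 * (8 * Real.exp k * (1 + k / 2) ^ 2 * (1 + k)) * ((5 + δ) / 5.95) ^ M ≤ 0.01 := by
  have h1 : (5 + δ) / 5.95 ≤ Real.exp (-0.163) := by
    refine Real.div_le_exp_neg_of_le 32 (by norm_num) ?_
    calc (5 + δ) / 5.95 ≤ (5 + 0.05) / 5.95 := by gcongr
      _ ≤ _ := by norm_num
  have h2 : ((5 + δ) / 5.95) ^ M ≤ Real.exp (-(2.0375 * k)) := by
    calc ((5 + δ) / 5.95) ^ M ≤ Real.exp (-0.163) ^ M := by gcongr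
      _ = Real.exp (-0.163 * M) := by rw [← Real.exp_nat_mul]; ring_nf
      _ ≤ _ := Real.exp_le_exp.2 (by linarith)
  have h3 : 1 + k ≤ 23.4 * Real.exp ((k - 22.4) / 23) := by
    have := Real.add_one_le_exp ((k - 22.4) / 23)
    linarith
  have h4 : 1 + k / 2 ≤ 12.2 * Real.exp ((k - 22.4) / 24) := by
    have := Real.add_one_le_exp ((k - 22.4) / 24)
    linarith
  have h5 : (9.7e9 : ℝ) ≤ Real.exp 23 := by
    calc (9.7e9 : ℝ) ≤ 2.7182818283 ^ 23 := by norm_num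
      _ ≤ Real.exp 1 ^ 23 := by gcongr; exact Real.exp_one_gt_d9.le
      _ = Real.exp 23 := by rw [← Real.exp_nat_mul]; norm_num
  have h6 : 0 ≤ 1 + k / 2 := by linarith
  calc 2600 * (8 * Real.exp k * (1 + k / 2) ^ 2 * (1 + k)) * ((5 + δ) / 5.95) ^ M
      ≤ 2600 * (8 * Real.exp k * (12.2 * Real.exp ((k - 22.4) / 24)) ^ 2 *
        (23.4 * Real.exp ((k - 22.4) / 23))) * Real.exp (-(2.0375 * k)) := by gcongr
    _ = 2600 * 8 * 12.2 ^ 2 * 23.4 * Real.exp (k + (k - 22.4) / 24 + (k - 22.4) / 24 +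
        (k - 22.4) / 23 + -(2.0375 * k)) := by
        rw [Real.exp_add, Real.exp_add, Real.exp_add, Real.exp_add]; ring
    _ ≤ 2600 * 8 * 12.2 ^ 2 * 23.4 * Real.exp (-23) := by
        gcongr
        linarith
    _ ≤ 2600 * 8 * 12.2 ^ 2 * 23.4 * (9.7e9)⁻¹ := by
        rw [Real.exp_neg]; gcongr
    _ ≤ 0.01 := by norm_num

theorem mul_exp_mul_le_of_le_of_le {X c K a b x : ℝ} (hX : 0 ≤ X)
    (ha : X * Real.exp (c * a) ≤ K * a)
    (hb : X * Real.exp (c * b) ≤ K * b) (hax : a ≤ x) (hxb : x ≤ b) :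
    X * Real.exp (c * x) ≤ K * x := by
  obtain ⟨t, u, ht, hu, htu, rfl⟩ : x ∈ segment ℝ a b := by
    rw [segment_eq_Icc (hax.trans hxb)]
    exact ⟨hax, hxb⟩
  have h := convexOn_exp.2 (Set.mem_univ (c * a)) (Set.mem_univ (c * b)) ht hu htu
  simp only [smul_eq_mul] at h ⊢
  calc X * Real.exp (c * (t * a + u * b)) = X * Real.exp (t * (c * a) + u * (c * b)) := by ring_nf
    _ ≤ X * (t * Real.exp (c * a) + u * Real.exp (c * b)) := by gcongr
    _ = t * (X * Real.exp (c * a)) + u * (X * Real.exp (c * b)) := by ring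
    _ ≤ t * (K * a) + u * (K * b) := by gcongr
    _ = _ := by ring

theorem mul_exp_mul_pow_le {k ε : ℝ} (hk : 22.4 ≤ k) (hε : 0 < ε) {M : ℕ} (hM1 : 12.5 * k ≤ M)
    (hM2 : M ≤ 12.5 * k + 1) {δ : ℝ} (hδ : 3 / (M - 1) ≤ δ) (hδε : δ ≤ ε / 4) :
    0.309 * ε ^ 2 * k * Real.exp (-(ε * k)) * ((5 + δ) / 5) ^ M ≤ 1.5 * δ := by
  have hk0 : 0 < k := by linarith
  have hM : 0 < (M : ℝ) - 1 := by linarith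
  set Y := ε * k with hY
  have hY0 : 0 < Y := by positivity
  have hδ0 : 0 < δ := lt_of_lt_of_le (by positivity) hδ
  have h1 : ((5 + δ) / 5) ^ M ≤ Real.exp (M / 5 * δ) := by
    have : (5 + δ) / 5 ≤ Real.exp (δ / 5) := by
      have := Real.add_one_le_exp (δ / 5)
      linarith
    calc ((5 + δ) / 5) ^ M ≤ Real.exp (δ / 5) ^ M := by gcongr
      _ = _ := by rw [← Real.exp_nat_mul]; ring_nf
  have hE : (2.718 : ℝ) ≤ Real.exp 1 := by linarith [Real.exp_one_gt_d9]
  refine le_trans (mul_le_mul_of_nonneg_left h1 (by positivity))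
    (mul_exp_mul_le_of_le_of_le (by positivity) ?_ ?_ hδ hδε)
  · have h2 : M / 5 * (3 / (M - 1) : ℝ) ≤ 0.603 := by
      rw [div_mul_div_comm, div_le_iff₀ (by positivity)]
      linarith
    have h3 : Real.exp 0.603 ≤ 2 := by
      have h4 : 0.603 ≤ Real.log 2 := by linarith [Real.log_two_gt_d9]
      calc _ ≤ Real.exp (Real.log 2) := Real.exp_le_exp.2 h4
        _ = 2 := Real.exp_log (by norm_num)
    have h5 : Y ^ 2 * Real.exp (-Y) ≤ 0.5415 := by
      have h6 := Real.add_one_le_exp (Y / 2 - 1)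
      have h7 : Real.exp (-Y) = (Real.exp (Y / 2 - 1) * Real.exp 1)⁻¹ ^ 2 := by
        rw [← Real.exp_add, ← Real.exp_neg, ← Real.exp_nat_mul]
        push_cast
        ring_nf
      have h8 : Y * (Real.exp (Y / 2 - 1) * Real.exp 1)⁻¹ ≤ 2 / 2.718 := by
        rw [← div_eq_mul_inv, div_le_div_iff₀ (by positivity) (by norm_num)]
        calc Y * 2.718 ≤ (2 * Real.exp (Y / 2 - 1)) * Real.exp 1 := by
              gcongr
              linarith
          _ = _ := by ring
      rw [h7, ← mul_pow]
      calc _ ≤ (2 / 2.718 : ℝ) ^ 2 := by gcongr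
        _ ≤ _ := by norm_num
    calc 0.309 * ε ^ 2 * k * Real.exp (-Y) * Real.exp (M / 5 * (3 / (M - 1)))
        ≤ 0.309 * ε ^ 2 * k * Real.exp (-Y) * 2 := by
          gcongr
          exact (Real.exp_le_exp.2 h2).trans h3
      _ = 0.618 / k * (Y ^ 2 * Real.exp (-Y)) := by rw [hY]; field_simp; ring
      _ ≤ 0.618 / k * 0.5415 := by gcongr
      _ ≤ 1.5 * (3 / (12.5 * k)) := by
          rw [div_mul_eq_mul_div, ← mul_div_assoc, div_le_div_iff₀ hk0 (by positivity)]
          linarith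
      _ ≤ _ := by gcongr; linarith
  · have h2 : M / 5 * (ε / 4) ≤ 0.63 * Y := by
      have : ε * M ≤ ε * (12.6 * k) := by gcongr; linarith
      rw [hY]
      linarith
    have h3 : Y * Real.exp (-(0.37 * Y)) ≤ 1 := by
      have h4 := Real.add_one_le_exp (0.37 * Y - 1)
      have h5 : Real.exp (0.37 * Y) = Real.exp (0.37 * Y - 1) * Real.exp 1 := by
        rw [← Real.exp_add]; ring_nf
      rw [Real.exp_neg, ← div_eq_mul_inv, div_le_one (Real.exp_pos _), h5]
      calc Y ≤ (0.37 * Y) * 2.718 := by linarith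
        _ ≤ _ := by gcongr; linarith
    calc 0.309 * ε ^ 2 * k * Real.exp (-Y) * Real.exp (M / 5 * (ε / 4))
        ≤ 0.309 * ε ^ 2 * k * Real.exp (-Y) * Real.exp (0.63 * Y) := by gcongr
      _ = 0.309 * ε * (Y * Real.exp (-(0.37 * Y))) := by
          rw [mul_assoc, ← Real.exp_add, show -Y + 0.63 * Y = -(0.37 * Y) by ring, hY]; ring
      _ ≤ 0.309 * ε * 1 := by gcongr
      _ ≤ _ := by linarith

theorem truncation_coefficient_pos {k : ℝ} (hk : 22.4 ≤ k) {M : ℕ}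
    (hM : 12.5 * k ≤ M) {B : ℝ}
    (hB : B = 2600 * (8 * Real.exp k * (1 + k / 2) ^ 2 * (1 + k))) :
    0 < 5 * (1 - 0.6) / (5 + 3 / (M - 1 : ℝ)) ^ (M + 1) - B / 5.95 ^ M *
      (1 / (1 - (5 + 3 / (M - 1 : ℝ)) / 5.95) +
        3 / (M - 1 : ℝ) / (5.95 * (1 - (5 + 3 / (M - 1 : ℝ)) / 5.95) ^ 2)) := by
  have hM1 : 279 ≤ (M - 1 : ℝ) := by linarith
  have hd0 : 0 < 3 / (M - 1 : ℝ) := by positivity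
  have hd : 3 / (M - 1 : ℝ) ≤ 0.05 := by
    rw [div_le_iff₀ (by linarith)]
    linarith
  set d : ℝ := 3 / (M - 1 : ℝ)
  have h1 := truncation_error_le_of_triple hk hd0.le hd hM
  rw [← hB] at h1
  have h2 : 0.15 ≤ 1 - (5 + d) / 5.95 := by
    have : (5 + d) / 5.95 ≤ (5 + 0.05) / 5.95 := by gcongr
    refine le_trans ?_ (sub_le_sub_left this 1)
    norm_num
  have h3 : 1 / (1 - (5 + d) / 5.95) + d / (5.95 * (1 - (5 + d) / 5.95) ^ 2) ≤ 10 := by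
    calc 1 / (1 - (5 + d) / 5.95) + d / (5.95 * (1 - (5 + d) / 5.95) ^ 2)
        ≤ 1 / 0.15 + 0.05 / (5.95 * 0.15 ^ 2) := by gcongr
      _ ≤ 10 := by norm_num
  have hB0 : 0 ≤ B := by
    have : 0 ≤ 1 + k := by linarith
    rw [hB]; positivity
  have h4 : B / 5.95 ^ M = B * ((5 + d) / 5.95) ^ M / (5 + d) ^ M := by
    rw [div_pow]; field_simp
  rw [sub_pos]
  calc _ ≤ B / 5.95 ^ M * 10 := by gcongr
    _ ≤ 0.01 / (5 + d) ^ M * 10 := by rw [h4]; gcongr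
    _ = 0.1 * (5 + d) / (5 + d) ^ (M + 1) := by rw [pow_succ]; field_simp; ring
    _ < _ := div_lt_div_of_pos_right (by linarith) (by positivity)

theorem false_of_hasDerivAt_zero_of_le {H : ℂ → ℂ} {y c : ℝ} (hc : 0 < c) (hy : 0 < y)
    (h0 : H ((1 - y : ℝ) : ℂ) = 0) (hH : HasDerivAt H 0 ((1 - y : ℝ) : ℂ))
    (h : ∀ x : ℝ, 0 < x → x < y → c * (y - x) ≤ ‖H ((1 - x : ℝ) : ℂ)‖) : False := by
  have h1 := (hasDerivAt_iff_isLittleO.1 hH).bound (half_pos hc)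
  have h2 : Filter.Tendsto (fun x : ℝ ↦ ((1 - x : ℝ) : ℂ)) (nhdsWithin y (Set.Iio y))
      (nhds ((1 - y : ℝ) : ℂ)) := by
    refine Filter.Tendsto.mono_left (Continuous.tendsto ?_ y) nhdsWithin_le_nhds
    fun_prop
  obtain ⟨x, hx, hx0, hxy⟩ := ((h2.eventually h1).and (Ioo_mem_nhdsLT hy)).exists
  have h3 := h x hx0 hxy
  have h4 : ‖((1 - x : ℝ) : ℂ) - ((1 - y : ℝ) : ℂ)‖ = y - x := by
    rw [← Complex.ofReal_sub, Complex.norm_real, Real.norm_of_nonneg (by linarith)]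
    ring
  rw [h0, sub_zero, smul_zero, sub_zero, h4] at hx
  nlinarith

theorem DirichletCharacter.norm_LFunction_le_of_norm_sub_six_eq {N : ℕ} [NeZero N]
    {χ : DirichletCharacter ℂ N} (hχ : χ ≠ 1) {s : ℂ} (hs : ‖s - 6‖ = 5.95) :
    ‖χ.LFunction s‖ ≤ 2 * √N * (1 + Real.log N) * 7.77 := by
  obtain ⟨hre, -, hQ⟩ := Complex.bounds_of_norm_sub_six_eq hs
  have hP := norm_sum_range_le hχ
  have := (norm_nonneg _).trans (hP 0)
  exact (norm_LFunction_le_of_pos_re hχ hP (by linarith)).trans (by gcongr)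

theorem DirichletCharacter.norm_LFunction_one_le_two_mul_sqrt_mul {N : ℕ} [NeZero N]
    {χ : DirichletCharacter ℂ N} (hχ : χ ≠ 1) :
    ‖χ.LFunction 1‖ ≤ 2 * √N * (1 + Real.log N) := by
  simpa using norm_LFunction_le_of_pos_re hχ (norm_sum_range_le hχ) (s := 1) (by simp)

theorem Real.sqrt_natCast_eq_exp {N : ℕ} (hN : N ≠ 0) : √(N : ℝ) = Real.exp (Real.log N / 2) := by
  rw [Real.sqrt_eq_rpow, Real.rpow_def_of_pos (by positivity)]
  ring_nf

theorem DirichletCharacter.mul_LFunction_one_re_le {N₁ N₂ N₃ : ℕ} [NeZero N₁] [NeZero N₂]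
    [NeZero N₃] {χ₁ : DirichletCharacter ℂ N₁} {χ₂ : DirichletCharacter ℂ N₂}
    {χ₃ : DirichletCharacter ℂ N₃} (hχ₁ : χ₁ ≠ 1) (hχ₂ : χ₂ ≠ 1) (hχ₃ : χ₃ ≠ 1)
    (h₁ : χ₁ ^ 2 = 1) (h₂ : χ₂ ^ 2 = 1) (hN : N₃ = N₁ * N₂)
    (hN₁ : 11.2 ≤ Real.log N₁) (hN₂ : 11.2 ≤ Real.log N₂) {ε : ℝ} (hε : 0 < ε)
    (hL₁ : (χ₁.LFunction 1).re ≤ 0.655 * ε / (N₁ : ℝ) ^ ε)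
    (hL₂ : (χ₂.LFunction 1).re ≤ 0.655 * ε / (N₂ : ℝ) ^ ε) :
    (χ₁.LFunction 1).re * ((χ₂.LFunction 1).re * (χ₃.LFunction 1).re) ≤
      0.309 * ε ^ 2 * Real.log N₃ * Real.exp (-(ε * Real.log N₃)) := by
  have hkk : Real.log N₃ = Real.log N₁ + Real.log N₂ := by
    rw [hN, Nat.cast_mul, Real.log_mul (by simp [NeZero.ne]) (by simp [NeZero.ne])]
  set k := Real.log N₃ with hk
  have hk22 : 22.4 ≤ k := by linarith
  have p₁ : 0 ≤ (χ₁.LFunction 1).re := by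
    simpa using LFunction_ofReal_re_nonneg hχ₁ h₁ one_pos fun t h1t ht ↦ absurd h1t ht.not_gt
  have p₂ : 0 ≤ (χ₂.LFunction 1).re := by
    simpa using LFunction_ofReal_re_nonneg hχ₂ h₂ one_pos fun t h1t ht ↦ absurd h1t ht.not_gt
  have q : ∀ {N : ℕ} [NeZero N], (0.655 * ε / (N : ℝ) ^ ε) =
      0.655 * ε * Real.exp (-(ε * Real.log N)) := fun {N} _ ↦ by
    have : 0 < (N : ℝ) := by exact_mod_cast NeZero.pos N
    rw [Real.rpow_def_of_pos this, Real.exp_neg, div_eq_mul_inv, mul_comm ε]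
  rw [q] at hL₁
  rw [q] at hL₂
  have hP₃ := norm_sum_range_le hχ₃
  rw [Real.sqrt_natCast_eq_exp (NeZero.ne N₃), ← hk] at hP₃
  have hP1 : 1 ≤ 2 * Real.exp (k / 2) * (1 + k) := by
    have := Real.one_le_exp (by linarith : 0 ≤ k / 2)
    exact one_le_mul_of_one_le_of_one_le (by linarith) (by linarith)
  have hL₃ : (χ₃.LFunction 1).re ≤ 0.72 * k := (Complex.re_le_norm _).trans
    ((norm_LFunction_one_le hχ₃ hP1 hP₃).trans (one_add_log_two_mul_exp_mul_le hk22))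
  have e : Real.exp (-(ε * k)) = Real.exp (-(ε * Real.log N₁)) * Real.exp (-(ε * Real.log N₂)) := by
    rw [← Real.exp_add, hkk]; ring_nf
  calc _ ≤ (χ₁.LFunction 1).re * ((χ₂.LFunction 1).re * (0.72 * k)) := by gcongr
    _ ≤ 0.655 * ε * Real.exp (-(ε * Real.log N₁)) *
        (0.655 * ε * Real.exp (-(ε * Real.log N₂)) * (0.72 * k)) := by
      gcongr
    _ = (0.655 * 0.655 * 0.72) * (ε ^ 2 * k * Real.exp (-(ε * k))) := by rw [e]; ring
    _ ≤ 0.309 * (ε ^ 2 * k * Real.exp (-(ε * k))) := by gcongr; norm_num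
    _ = _ := by ring

theorem DirichletCharacter.not_two_real_zeros {N₁ N₂ N₃ : ℕ} [NeZero N₁] [NeZero N₂] [NeZero N₃]
    {χ₁ : DirichletCharacter ℂ N₁} {χ₂ : DirichletCharacter ℂ N₂} {χ₃ : DirichletCharacter ℂ N₃}
    (hχ₁ : χ₁ ≠ 1) (hχ₂ : χ₂ ≠ 1) (hχ₃ : χ₃ ≠ 1)
    (h₁ : χ₁ ^ 2 = 1) (h₂ : χ₂ ^ 2 = 1) (h₃ : χ₃ ^ 2 = 1)
    (hN : N₃ = N₁ * N₂) (hχ : ∀ n : ℕ, χ₃ n = χ₁ n * χ₂ n)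
    (hN₁ : 11.2 ≤ Real.log N₁) (hN₂ : 11.2 ≤ Real.log N₂) {ε : ℝ} (hε : 0 < ε)
    (hL₁ : (χ₁.LFunction 1).re ≤ 0.655 * ε / (N₁ : ℝ) ^ ε)
    (hL₂ : (χ₂.LFunction 1).re ≤ 0.655 * ε / (N₂ : ℝ) ^ ε)
    {x y : ℝ} (hx : 0 < x) (hxy : x ≤ y) (hy : y ≤ 0.05) (hyε : y ≤ ε / 4)
    (hx₁ : χ₁.LFunction ((1 - x : ℝ) : ℂ) = 0) (hy₂ : χ₂.LFunction ((1 - y : ℝ) : ℂ) = 0) :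
    False := by
  obtain ⟨b, hb, hb2, hab, hHb⟩ := exists_coeff_zeta_mul_LFunction_mul h₁ h₂ hχ
  set k₁ := Real.log N₁ with hk₁
  set k₂ := Real.log N₂ with hk₂
  set k := k₁ + k₂ with hk
  have hk22 : 22.4 ≤ k := by linarith
  have hkN₃ : Real.log N₃ = k := by
    rw [hN, Nat.cast_mul, Real.log_mul (by simp [NeZero.ne]) (by simp [NeZero.ne])]
  set G : ℂ → ℂ := fun s ↦ χ₁.LFunction s * (χ₂.LFunction s * χ₃.LFunction s) with hG
  set H : ℂ → ℂ := fun s ↦ riemannZeta₁ s * G s with hH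
  have hGd : Differentiable ℂ G := (differentiable_LFunction hχ₁).mul
    ((differentiable_LFunction hχ₂).mul (differentiable_LFunction hχ₃))
  have hHd : Differentiable ℂ H := differentiable_riemannZeta₁.mul hGd
  set l₁ := (χ₁.LFunction 1).re with hl₁
  set l₂ := (χ₂.LFunction 1).re with hl₂
  set l₃ := (χ₃.LFunction 1).re with hl₃
  set l := l₁ * (l₂ * l₃) with hl
  have hG1 : G 1 = l := by
    have e₁ := ofReal_re_LFunction_ofReal hχ₁ h₁ one_pos
    have e₂ := ofReal_re_LFunction_ofReal hχ₂ h₂ one_pos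
    have e₃ := ofReal_re_LFunction_ofReal hχ₃ h₃ one_pos
    rw [Complex.ofReal_one] at e₁ e₂ e₃
    rw [hl, Complex.ofReal_mul, Complex.ofReal_mul, e₁, e₂, e₃]
  have hH1 : H 1 = l := by simp only [hH, riemannZeta₁_one, one_mul, hG1]
  set B := 2600 * (8 * Real.exp k * (1 + k / 2) ^ 2 * (1 + k)) with hB
  have hBs : ∀ s : ℂ, ‖s - 6‖ = 5.95 → ‖H s - l‖ ≤ B * ‖s - 1‖ := fun s hs ↦ by
    have g₁ := norm_LFunction_le_of_norm_sub_six_eq hχ₁ hs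
    have g₂ := norm_LFunction_le_of_norm_sub_six_eq hχ₂ hs
    have g₃ := norm_LFunction_le_of_norm_sub_six_eq hχ₃ hs
    have f₁ := norm_LFunction_one_le_two_mul_sqrt_mul hχ₁
    have f₂ := norm_LFunction_one_le_two_mul_sqrt_mul hχ₂
    have f₃ := norm_LFunction_one_le_two_mul_sqrt_mul hχ₃
    set P₁ := 2 * √(N₁ : ℝ) * (1 + Real.log N₁) with hP₁
    set P₂ := 2 * √(N₂ : ℝ) * (1 + Real.log N₂) with hP₂
    set P₃ := 2 * √(N₃ : ℝ) * (1 + Real.log N₃) with hP₃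
    have hP : P₁ * (P₂ * P₃) ≤ 8 * Real.exp k * (1 + k / 2) ^ 2 * (1 + k) := by
      rw [hP₁, hP₂, hP₃, Real.sqrt_natCast_eq_exp (NeZero.ne N₁),
        Real.sqrt_natCast_eq_exp (NeZero.ne N₂), Real.sqrt_natCast_eq_exp (NeZero.ne N₃), hkN₃,
        ← hk₁, ← hk₂]
      have e : Real.exp k = Real.exp (k₁ / 2) * Real.exp (k₂ / 2) * Real.exp (k / 2) := by
        rw [← Real.exp_add, ← Real.exp_add, hk]; ring_nf
      have : (1 + k₁) * (1 + k₂) ≤ (1 + k / 2) ^ 2 := by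
        rw [hk]
        nlinarith [sq_nonneg (k₁ - k₂)]
      have h1k : 0 ≤ 1 + k := by linarith
      calc _ = 8 * Real.exp k * ((1 + k₁) * (1 + k₂)) * (1 + k) := by rw [e]; ring
        _ ≤ _ := by gcongr
    have p₁ := (norm_nonneg _).trans f₁
    have p₂ := (norm_nonneg _).trans f₂
    have hGs : ‖G s‖ ≤ 7.77 ^ 3 * (P₁ * (P₂ * P₃)) := by
      calc ‖G s‖ = ‖χ₁.LFunction s‖ * (‖χ₂.LFunction s‖ * ‖χ₃.LFunction s‖) := by
            rw [hG, norm_mul, norm_mul]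
        _ ≤ (P₁ * 7.77) * ((P₂ * 7.77) * (P₃ * 7.77)) := by gcongr
        _ = _ := by ring
    have hGo : ‖G 1‖ ≤ P₁ * (P₂ * P₃) := by
      calc ‖G 1‖ = ‖χ₁.LFunction 1‖ * (‖χ₂.LFunction 1‖ * ‖χ₃.LFunction 1‖) := by
            rw [hG, norm_mul, norm_mul]
        _ ≤ _ := by gcongr
    have hPP := (norm_nonneg _).trans hGo
    rw [← hG1]
    refine (norm_riemannZeta₁_mul_sub_le hs hGs hGo).trans ?_
    gcongr
    calc _ = (4.385 * 7.77 ^ 3 + (7.77 ^ 3 + 1) / 0.95) * (P₁ * (P₂ * P₃)) := by ring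
      _ ≤ 2600 * (P₁ * (P₂ * P₃)) := by gcongr; norm_num
      _ ≤ B := by rw [hB]; exact mul_le_mul_of_nonneg_left hP (by norm_num)
  obtain ⟨g, hg, hA, hδH⟩ := exists_taylor_coeff_LSeries hb hab hHd
    (fun s hs ↦ by rw [← hHb s hs, mul_assoc]) hH1 (R := 5.95) (by norm_num) hBs
  have ha : ∀ m, 0 ≤ g m + l / 5 ^ (m + 1) := fun m ↦ by simpa using hA m ∅ (by simp)
  have ha0 : 1 ≤ g 0 + l / 5 := by
    have := hA 0 {1} (by simp)
    simp at this
    have := hb2 1 one_ne_zero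
    simp at this
    linarith
  have hzero : ∀ z : ℝ, 0 < z → z ≤ 0.05 → H ((1 - z : ℝ) : ℂ) = 0 →
      l - z * ∑' m, g m * (5 + z) ^ m = 0 := fun z hz hz' h0 ↦ by
    rw [hδH z hz (by norm_num; linarith)] at h0
    exact_mod_cast h0
  have hHx : H ((1 - x : ℝ) : ℂ) = 0 := by simp only [hH, hG, hx₁, zero_mul, mul_zero]
  have hHy : H ((1 - y : ℝ) : ℂ) = 0 := by simp only [hH, hG, hy₂, zero_mul, mul_zero]
  have hy0 : 0 < y := hx.trans_le hxy
  set M := ⌈12.5 * k⌉₊ with hM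
  have hM1 : 12.5 * k ≤ M := Nat.le_ceil _
  have hM2 : (M : ℝ) ≤ 12.5 * k + 1 := (Nat.ceil_lt_add_one (by positivity)).le
  have hM100 : 100 ≤ M := by
    have : (100 : ℝ) ≤ M := by linarith
    exact_mod_cast this
  have hM1' : 0 < (M - 1 : ℝ) := by linarith
  have hdy : 3 / (M - 1 : ℝ) < y := by
    by_contra! hyd
    have hC := truncation_coefficient_pos hk22 hM1 hB
    have hlin := fun z hz hzy ↦ mul_le_sub_mul_tsum_of_eq_zero hg ha ha0 (by omega : 1 ≤ M)
      (x := z) (y := y) (d := 3 / (M - 1 : ℝ)) (θ := 0.6) (by norm_num) (by norm_num)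
      (by rw [mul_div_cancel₀ _ hM1'.ne']; norm_num)
      (by
        have : 3 / (M - 1 : ℝ) ≤ 0.05 := by
          rw [div_le_iff₀ hM1']
          linarith
        linarith) hz hzy hyd hC.le (hzero y hy0 hy hHy)
    have hc := mul_pos (by positivity : (0 : ℝ) < 5 ^ M) hC
    rcases hxy.eq_or_lt with rfl | hxy'
    · refine false_of_hasDerivAt_zero_of_le hc hx hHx ?_ fun z hz hzx ↦ ?_
      · have d₂₃ := ((differentiable_LFunction hχ₂).mul (differentiable_LFunction hχ₃)
          ((1 - x : ℝ) : ℂ)).hasDerivAt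
        have d₁ := (differentiable_LFunction hχ₁ ((1 - x : ℝ) : ℂ)).hasDerivAt
        have d := (differentiable_riemannZeta₁ ((1 - x : ℝ) : ℂ)).hasDerivAt
        refine (d.mul (d₁.mul d₂₃)).congr_deriv ?_
        simp only [Pi.mul_apply, hx₁, hy₂, zero_mul, mul_zero, add_zero]
      · rw [hδH z hz (by norm_num; linarith), Complex.norm_real]
        exact (hlin z hz hzx.le).trans (le_abs_self _)
    · have := hlin x hx hxy
      rw [hzero x hx (hxy.trans hy) hHx] at this
      exact absurd this (not_le.2 (mul_pos hc (by linarith)))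
  have hl_le : l ≤ 0.309 * ε ^ 2 * k * Real.exp (-(ε * k)) := by
    rw [← hkN₃]
    exact mul_LFunction_one_re_le hχ₁ hχ₂ hχ₃ h₁ h₂ hN hN₁ hN₂ hε hL₁ hL₂
  have h5 := mul_le_mul_pow_of_nonneg hg M hy0 (by linarith) (hzero y hy0 hy hHy).ge
  have h6 := sum_range_taylor_ge hb2 hA (u := 5 + y) (by linarith) (by linarith) hM100
  have h7 : B * ((5 + y) / 5.95) ^ M / (1 - (5 + y) / 5.95) ≤ 0.1 := by
    have h7 := truncation_error_le_of_triple hk22 hy0.le hy hM1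
    rw [← hB] at h7
    have h8 : 0.15 ≤ 1 - (5 + y) / 5.95 := by
      have : (5 + y) / 5.95 ≤ (5 + 0.05) / 5.95 := by gcongr
      refine le_trans ?_ (sub_le_sub_left this 1)
      norm_num
    calc _ ≤ 0.01 / (0.15 : ℝ) := by gcongr
      _ ≤ 0.1 := by norm_num
  have h8 := mul_exp_mul_pow_le hk22 hε hM1 hM2 hdy.le hyε
  have h9 : l * ((5 + y) / 5) ^ M ≤ 1.5 * y := le_trans (by gcongr) h8
  have h10 : y * (1.625 - 0.1) ≤ y * (∑ m ∈ Finset.range M, (g m + l / 5 ^ (m + 1)) * (5 + y) ^ m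
      - B * ((5 + y) / 5.95) ^ M / (1 - (5 + y) / 5.95)) := by gcongr
  linarith

theorem LFunc_eq_LFunction {N : ℕ} [NeZero N] (χ : DirichletCharacter ℂ N) (s : ℂ) :
    LFunc χ s = χ.LFunction s := by
  simp [LFunc, NeZero.ne N]

theorem Int.le_log_natAbs_of_max_exp_le {D : ℤ} {a b : ℝ}
    (h : max (Real.exp a) (Real.exp b) ≤ |(D : ℝ)|) :
    a ≤ Real.log D.natAbs ∧ b ≤ Real.log D.natAbs := by
  rw [Nat.cast_natAbs, Int.cast_abs]
  obtain ⟨h₁, h₂⟩ := max_le_iff.1 h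
  exact ⟨(Real.le_log_iff_exp_le ((Real.exp_pos _).trans_le h₁)).2 h₁,
    (Real.le_log_iff_exp_le ((Real.exp_pos _).trans_le h₂)).2 h₂⟩

theorem exists_real_zero_of_LFunction_one_le {D : ℤ} (hD : D < 0) {ε : ℝ} (hε : 0 < ε)
    (h : max (Real.exp (1 / ε)) (Real.exp 11.2) ≤ |(D : ℝ)|) [NeZero D.natAbs]
    {χ : DirichletCharacter ℂ D.natAbs} (hχ : IsKroneckerChar D χ)
    (hL : (χ.LFunction 1).re ≤ 0.655 * ε / (D.natAbs : ℝ) ^ ε) :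
    ∃ x : ℝ, 0 < x ∧ x < 0.05 ∧ x < ε / 4 ∧ χ.LFunction ((1 - x : ℝ) : ℂ) = 0 := by
  obtain ⟨h₁, h₂⟩ := Int.le_log_natAbs_of_max_exp_le h
  by_contra! hc
  refine hL.not_gt (DirichletCharacter.lt_LFunction_one_of_ne_zero (hχ.ne_one hD)
    (hχ.sq_eq_one hD.ne) hε h₂ ?_ fun x hx hx' hx1 ↦ ?_)
  · rwa [div_le_iff₀ hε, mul_comm] at h₁
  · have := hc (1 - x) (by linarith) (by norm_num at hx' ⊢; linarith) (by linarith)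
    rwa [sub_sub_cancel] at this

theorem DirichletCharacter.exists_mul_eq {N₁ N₂ : ℕ} (χ₁ : DirichletCharacter ℂ N₁)
    (χ₂ : DirichletCharacter ℂ N₂) (h₁ : χ₁ ^ 2 = 1) (h₂ : χ₂ ^ 2 = 1) :
    (changeLevel (Nat.dvd_mul_right N₁ N₂) χ₁ * changeLevel (Nat.dvd_mul_left N₂ N₁) χ₂) ^ 2 = 1 ∧
    ∀ n : ℕ, (changeLevel (Nat.dvd_mul_right N₁ N₂) χ₁ *
      changeLevel (Nat.dvd_mul_left N₂ N₁) χ₂) n = χ₁ n * χ₂ n := by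
  refine ⟨by rw [mul_pow, ← map_pow, ← map_pow, h₁, h₂, map_one, map_one, one_mul], fun n ↦ ?_⟩
  rw [MulChar.mul_apply]
  by_cases hn : IsUnit (n : ZMod (N₁ * N₂))
  · have e₁ := changeLevel_eq_cast_of_dvd χ₁ (Nat.dvd_mul_right N₁ N₂) hn.unit
    have e₂ := changeLevel_eq_cast_of_dvd χ₂ (Nat.dvd_mul_left N₂ N₁) hn.unit
    rw [IsUnit.unit_spec, ZMod.cast_natCast (Nat.dvd_mul_right N₁ N₂)] at e₁
    rw [IsUnit.unit_spec, ZMod.cast_natCast (Nat.dvd_mul_left N₂ N₁)] at e₂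
    rw [e₁, e₂]
  · rw [MulChar.map_nonunit _ hn, zero_mul]
    rw [ZMod.isUnit_iff_coprime, Nat.coprime_mul_iff_right, not_and_or, ← ZMod.isUnit_iff_coprime,
      ← ZMod.isUnit_iff_coprime] at hn
    obtain hn | hn := hn <;> simp [MulChar.map_nonunit _ hn]

theorem eq_of_LFunction_one_le {ε : ℝ} (hε : 0 < ε) {D₁ D₂ : ℤ}
    (h₁ : IsFundamentalDiscriminant D₁) (h₂ : IsFundamentalDiscriminant D₂)
    (hD₁ : D₁ < 0) (hD₂ : D₂ < 0)
    (hm₁ : max (Real.exp (1 / ε)) (Real.exp 11.2) ≤ |(D₁ : ℝ)|)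
    (hm₂ : max (Real.exp (1 / ε)) (Real.exp 11.2) ≤ |(D₂ : ℝ)|)
    [NeZero D₁.natAbs] [NeZero D₂.natAbs]
    {χ₁ : DirichletCharacter ℂ D₁.natAbs} {χ₂ : DirichletCharacter ℂ D₂.natAbs}
    (hχ₁ : IsKroneckerChar D₁ χ₁) (hχ₂ : IsKroneckerChar D₂ χ₂)
    (hL₁ : (χ₁.LFunction 1).re ≤ 0.655 * ε / (D₁.natAbs : ℝ) ^ ε)
    (hL₂ : (χ₂.LFunction 1).re ≤ 0.655 * ε / (D₂.natAbs : ℝ) ^ ε) : D₁ = D₂ := by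
  by_contra hne
  have hsq : ¬ IsSquare (D₁ * D₂) := fun h ↦ hne (h₁.eq_of_isSquare_mul h₂ h)
  obtain ⟨x, hx, hx', hxε, hx0⟩ := exists_real_zero_of_LFunction_one_le hD₁ hε hm₁ hχ₁ hL₁
  obtain ⟨y, hy, hy', hyε, hy0⟩ := exists_real_zero_of_LFunction_one_le hD₂ hε hm₂ hχ₂ hL₂
  have hN₁ := (Int.le_log_natAbs_of_max_exp_le hm₁).2
  have hN₂ := (Int.le_log_natAbs_of_max_exp_le hm₂).2
  have s₁ := hχ₁.sq_eq_one hD₁.ne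
  have s₂ := hχ₂.sq_eq_one hD₂.ne
  have hne₃ := IsKroneckerChar.changeLevel_mul_ne_one hsq hχ₁ hχ₂
  obtain ⟨s₃, hχ₃⟩ := DirichletCharacter.exists_mul_eq χ₁ χ₂ s₁ s₂
  rcases le_total x y with hxy | hxy
  · exact DirichletCharacter.not_two_real_zeros (hχ₁.ne_one hD₁) (hχ₂.ne_one hD₂) hne₃ s₁ s₂ s₃
      rfl hχ₃ hN₁ hN₂ hε hL₁ hL₂ hx hxy hy'.le hyε.le hx0 hy0
  · exact DirichletCharacter.not_two_real_zeros (hχ₂.ne_one hD₂) (hχ₁.ne_one hD₁) hne₃ s₂ s₁ s₃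
      (mul_comm _ _) (fun n ↦ (hχ₃ n).trans (mul_comm _ _)) hN₂ hN₁ hε hL₂ hL₁ hy hxy hx'.le
      hxε.le hy0 hx0

/-- (Tatuzawa) Let `0 < ε < 1/2`. There is at most one fundamental discriminant `D < 0` with
`|D| ≥ max(e^{1/ε}, e^{11.2})` and `L(1, χ_D) ≤ 0.655·ε/|D|^ε`; moreover for such an
exceptional `D`, `L(s, χ_D)` has a real zero `s` with `1 − ε/4 < s < 1`. -/
theorem tatuzawa (ε : ℝ) (hε0 : 0 < ε) (hε : ε < 1 / 2) :
    (∀ D₁ D₂ : ℤ,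
      (IsFundamentalDiscriminant D₁ ∧ D₁ < 0 ∧
        max (Real.exp (1 / ε)) (Real.exp 11.2) ≤ |(D₁ : ℝ)| ∧
        ∀ χ : DirichletCharacter ℂ D₁.natAbs, IsKroneckerChar D₁ χ →
          (LFunc χ 1).re ≤ 0.655 * ε / |(D₁ : ℝ)| ^ ε) →
      (IsFundamentalDiscriminant D₂ ∧ D₂ < 0 ∧
        max (Real.exp (1 / ε)) (Real.exp 11.2) ≤ |(D₂ : ℝ)| ∧
        ∀ χ : DirichletCharacter ℂ D₂.natAbs, IsKroneckerChar D₂ χ →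
          (LFunc χ 1).re ≤ 0.655 * ε / |(D₂ : ℝ)| ^ ε) →
      D₁ = D₂) ∧
    ∀ D : ℤ,
      (IsFundamentalDiscriminant D ∧ D < 0 ∧
        max (Real.exp (1 / ε)) (Real.exp 11.2) ≤ |(D : ℝ)| ∧
        ∀ χ : DirichletCharacter ℂ D.natAbs, IsKroneckerChar D χ →
          (LFunc χ 1).re ≤ 0.655 * ε / |(D : ℝ)| ^ ε) →
      ∀ χ : DirichletCharacter ℂ D.natAbs, IsKroneckerChar D χ →
        ∃ s : ℝ, 1 - ε / 4 < s ∧ s < 1 ∧ LFunc χ (s : ℂ) = 0 := by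
  have key {D : ℤ} (χ : DirichletCharacter ℂ D.natAbs) [NeZero D.natAbs]
      (h : (LFunc χ 1).re ≤ 0.655 * ε / |(D : ℝ)| ^ ε) :
      (χ.LFunction 1).re ≤ 0.655 * ε / (D.natAbs : ℝ) ^ ε := by
    rwa [LFunc_eq_LFunction, ← Int.cast_abs, ← Nat.cast_natAbs] at h
  refine ⟨?_, ?_⟩
  · rintro D₁ D₂ ⟨h₁, hD₁, hm₁, hL₁⟩ ⟨h₂, hD₂, hm₂, hL₂⟩
    have : NeZero D₁.natAbs := ⟨Int.natAbs_ne_zero.2 hD₁.ne⟩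
    have : NeZero D₂.natAbs := ⟨Int.natAbs_ne_zero.2 hD₂.ne⟩
    obtain ⟨χ₁, hχ₁⟩ := h₁.exists_isKroneckerChar hD₁
    obtain ⟨χ₂, hχ₂⟩ := h₂.exists_isKroneckerChar hD₂
    exact eq_of_LFunction_one_le hε0 h₁ h₂ hD₁ hD₂ hm₁ hm₂ hχ₁ hχ₂
      (key χ₁ (hL₁ χ₁ hχ₁)) (key χ₂ (hL₂ χ₂ hχ₂))
  · rintro D ⟨-, hD, hm, hL⟩ χ hχ
    have : NeZero D.natAbs := ⟨Int.natAbs_ne_zero.2 hD.ne⟩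
    obtain ⟨x, hx, -, hxε, hx0⟩ :=
      exists_real_zero_of_LFunction_one_le hD hε0 hm hχ (key χ (hL χ hχ))
    exact ⟨1 - x, by linarith, by linarith, by rw [LFunc_eq_LFunction, hx0]⟩
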